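/- arXiv:1705.03238 — 4 statements merged into one kernel-verified Lean document; each statement's English description precedes it below -/
import Mathlib

section
/- Let X be a semitopological semilattice satisfying the separation axiom T₁ such that for every isomorphic topological embedding f of X into a semitopological semilattice Y satisfying T₁ the image f(X) is closed in Y. Then every point p ∈ X with X = ↑p ∪ ↓p is either an isolated point of X or satisfies p = x ⊓ y for some points x, y ∈ X \ {p}. -/
open Set Topology

universe u

inductive Opt (X : Type u) : Type u
  | nn : Opt X
  | ss : X → Opt X

theorem Opt.ss_injective (X : Type u) : Function.Injective (Opt.ss : X → Opt X) :=
  fun _ _ h => Opt.ss.inj h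

open Classical in
/-- one-point extension, the new point sits right below `p` -/
noncomputable def inf1 {X : Type u} [SemilatticeInf X] (p : X) : Opt X → Opt X → Opt X
  | Opt.ss a, Opt.ss b => Opt.ss (a ⊓ b)
  | Opt.ss a, Opt.nn => if p ≤ a then Opt.nn else Opt.ss a
  | Opt.nn, Opt.ss a => if p ≤ a then Opt.nn else Opt.ss a
  | Opt.nn, Opt.nn => Opt.nn

@[reducible] noncomputable def lat1 {X : Type u} [SemilatticeInf X] (p : X)
    (hp : ∀ x, p ≤ x ∨ x ≤ p) : SemilatticeInf (Opt X) :=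
  letI : Min (Opt X) := ⟨inf1 p⟩
  SemilatticeInf.mk'
    (by
      rintro (_ | a) (_ | b)
      · rfl
      · rfl
      · rfl
      · exact congrArg Opt.ss (inf_comm a b))
    (by
      have key : ∀ a b : X, ¬ p ≤ b → p ≤ a → a ⊓ b = b := fun a b h h' =>
        inf_eq_right.2 (((hp b).resolve_left h).trans h')
      have key' : ∀ a b : X, ¬ p ≤ b → p ≤ a → b ⊓ a = b := fun a b h h' =>
        inf_eq_left.2 (((hp b).resolve_left h).trans h')
      rintro (_ | a) (_ | b) (_ | c) <;> change inf1 p (inf1 p _ _) _ = inf1 p _ (inf1 p _ _)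
      · rfl
      · by_cases h : p ≤ c <;> simp [inf1, h]
      · by_cases h : p ≤ b <;> simp [inf1, h]
      · by_cases h : p ≤ b <;> by_cases h' : p ≤ c <;> simp [inf1, h, h', key]
      · by_cases h : p ≤ a <;> simp [inf1, h]
      · by_cases h : p ≤ a <;> by_cases h' : p ≤ c <;> simp [inf1, h, h', key, key']
      · by_cases h : p ≤ a <;> by_cases h' : p ≤ b <;> simp [inf1, h, h', key, key']
      · simp [inf1, inf_assoc])
    (by
      rintro (_ | a)
      · rfl
      · exact congrArg Opt.ss (inf_idem a))

@[reducible] def top1 {X : Type u} [SemilatticeInf X] [TopologicalSpace X] (p : X) :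
    TopologicalSpace (Opt X) where
  IsOpen W := IsOpen (Opt.ss ⁻¹' W) ∧
    (Opt.nn ∈ W → ∃ V : Set X, IsOpen V ∧ p ∈ V ∧ ∀ y ∈ V, y < p → Opt.ss y ∈ W)
  isOpen_univ := ⟨isOpen_univ, fun _ => ⟨univ, isOpen_univ, mem_univ _, fun _ _ _ => mem_univ _⟩⟩
  isOpen_inter := by
    rintro s t ⟨hs, hs'⟩ ⟨ht, ht'⟩
    refine ⟨hs.inter ht, fun h => ?_⟩
    obtain ⟨V, hV, hpV, h1⟩ := hs' h.1
    obtain ⟨V', hV', hpV', h1'⟩ := ht' h.2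
    exact ⟨V ∩ V', hV.inter hV', ⟨hpV, hpV'⟩, fun y hy hyp => ⟨h1 y hy.1 hyp, h1' y hy.2 hyp⟩⟩
  isOpen_sUnion := by
    intro S hS
    refine ⟨?_, ?_⟩
    · rw [preimage_sUnion]
      exact isOpen_biUnion fun t ht => (hS t ht).1
    · rintro ⟨t, ht, h⟩
      obtain ⟨V, hV, hpV, h1⟩ := (hS t ht).2 h
      exact ⟨V, hV, hpV, fun y hy hyp => ⟨t, ht, h1 y hy hyp⟩⟩

theorem case1 {X : Type u} [SemilatticeInf X] [TopologicalSpace X] [T1Space X]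
    (hsep₁ : ∀ a : X, Continuous fun x : X => a ⊓ x)
    (H : ∀ (Y : Type u) [SemilatticeInf Y] [TopologicalSpace Y] [T1Space Y],
      (∀ a : Y, Continuous fun y : Y => a ⊓ y) →
      (∀ a : Y, Continuous fun y : Y => y ⊓ a) →
      ∀ f : X → Y, (∀ a b : X, f (a ⊓ b) = f a ⊓ f b) → IsEmbedding f →
        IsClosed (Set.range f))
    (p : X) (hp : ∀ x, p ≤ x ∨ x ≤ p) :
    ∃ V : Set X, IsOpen V ∧ p ∈ V ∧ ∀ y ∈ V, ¬ y < p := by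
  let L1 := lat1 p hp
  let T1 := top1 p
  have openiff : ∀ W : Set (Opt X), IsOpen W ↔ (IsOpen (Opt.ss ⁻¹' W) ∧
    (Opt.nn ∈ W → ∃ V : Set X, IsOpen V ∧ p ∈ V ∧ ∀ y ∈ V, y < p → Opt.ss y ∈ W)) := fun W => Iff.rfl
  have hIci : IsClosed (Ici p) := by
    have : Ici p = (fun x => p ⊓ x) ⁻¹' {p} := by ext x; simp
    rw [this]
    exact isClosed_singleton.preimage (hsep₁ p)
  have hlt : ∀ x, ¬ p ≤ x ↔ x < p := fun x =>
    ⟨fun h => lt_of_le_not_ge ((hp x).resolve_left h) h, fun h => not_le_of_gt h⟩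
  have i1 : ∀ a b : X, (Opt.ss a : Opt X) ⊓ Opt.ss b = Opt.ss (a ⊓ b) := fun a b => rfl
  have i2 : ∀ a : X, p ≤ a → (Opt.nn : Opt X) ⊓ Opt.ss a = Opt.nn := fun a h => by
    change inf1 p _ _ = _
    simp [inf1, h]
  have i3 : ∀ a : X, ¬ p ≤ a → (Opt.nn : Opt X) ⊓ Opt.ss a = Opt.ss a := fun a h => by
    change inf1 p _ _ = _
    simp [inf1, h]
  have i4 : (Opt.nn : Opt X) ⊓ Opt.nn = Opt.nn := rfl
  have T : T1Space (Opt X) := by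
    refine ⟨fun z => ?_⟩
    rw [← isOpen_compl_iff, openiff]
    rcases z with _ | a
    · refine ⟨?_, by simp⟩
      convert isOpen_univ (X := X)
      ext x; simp
    · have : (Opt.ss ⁻¹' ({Opt.ss a}ᶜ) : Set X) = {a}ᶜ := by ext x; simp
      refine ⟨this ▸ isOpen_compl_singleton, fun _ => ?_⟩
      by_cases hap : a = p
      · exact ⟨univ, isOpen_univ, mem_univ _, fun y _ hy => by
          subst hap; simpa using hy.ne⟩
      · exact ⟨{a}ᶜ, isOpen_compl_singleton, fun h => hap h.symm, fun y hy _ => by simpa using hy⟩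
  have C : ∀ a : Opt X, Continuous fun y : Opt X => a ⊓ y := by
    intro a
    refine ⟨fun W hW => ?_⟩
    rw [openiff] at hW ⊢
    obtain ⟨hW1, hW2⟩ := hW
    rcases a with _ | a
    · constructor
      · by_cases hn : (Opt.nn : Opt X) ∈ W
        · obtain ⟨V, hV, hpV, h1⟩ := hW2 hn
          have : (Opt.ss ⁻¹' ((fun y : Opt X => Opt.nn ⊓ y) ⁻¹' W) : Set X)
              = ((Ici p)ᶜ ∩ Opt.ss ⁻¹' W) ∪ (fun y => p ⊓ y) ⁻¹' V := by
            ext y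
            by_cases hy : p ≤ y
            · simp [i2 y hy, hn, inf_eq_left.2 hy, hpV]
            · have hy' := (hlt y).1 hy
              simp only [mem_preimage, i3 y hy, mem_union, mem_inter_iff, mem_compl_iff, mem_Ici,
                hy, not_false_eq_true, true_and, inf_eq_right.2 hy'.le]
              exact ⟨Or.inl, fun h => h.elim id fun h => h1 y h hy'⟩
          rw [this]
          exact (hIci.isOpen_compl.inter hW1).union (hV.preimage (hsep₁ p))
        · have : (Opt.ss ⁻¹' ((fun y : Opt X => Opt.nn ⊓ y) ⁻¹' W) : Set X)
              = ((Ici p)ᶜ ∩ Opt.ss ⁻¹' W) := by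
            ext y
            by_cases hy : p ≤ y
            · simp [i2 y hy, hn, hy]
            · simp [i3 y hy, hy]
          rw [this]
          exact (hIci.isOpen_compl.inter hW1)
      · intro hn
        obtain ⟨V, hV, hpV, h1⟩ := hW2 hn
        refine ⟨V, hV, hpV, fun y hy hyp => ?_⟩
        simp only [mem_preimage, i3 y ((hlt y).2 hyp)]
        exact h1 y hy hyp
    · refine ⟨hW1.preimage (hsep₁ a), fun hn => ?_⟩
      simp only [mem_preimage] at hn
      rw [inf_comm] at hn
      by_cases ha : p ≤ a
      · rw [i2 a ha] at hn
        obtain ⟨V, hV, hpV, h1⟩ := hW2 hn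
        refine ⟨V, hV, hpV, fun y hy hyp => ?_⟩
        simp only [mem_preimage, i1, inf_eq_right.2 (hyp.le.trans ha)]
        exact h1 y hy hyp
      · rw [i3 a ha] at hn
        refine ⟨_, hW1.preimage (hsep₁ a), ?_, fun y hy _ => hy⟩
        simpa [inf_eq_left.2 ((hlt a).1 ha).le] using hn
  have E : IsEmbedding (Opt.ss : X → Opt X) := by
    refine ⟨⟨?_⟩, Opt.ss_injective X⟩
    ext V
    rw [isOpen_induced_iff]
    constructor
    · intro hV
      refine ⟨Opt.ss '' V, ?_, preimage_image_eq _ (Opt.ss_injective X)⟩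
      rw [openiff, preimage_image_eq _ (Opt.ss_injective X)]
      exact ⟨hV, by simp⟩
    · rintro ⟨W, hW, rfl⟩
      exact hW.1
  have K := H (Opt X) C (fun a => by simpa only [inf_comm] using C a) Opt.ss i1 E
  rw [← isOpen_compl_iff, openiff] at K
  obtain ⟨V, hV, hpV, h1⟩ := K.2 (by simp)
  exact ⟨V, hV, hpV, fun y hy hyp => by simpa using h1 y hy hyp⟩

/-- doubling of the points above `p` -/
@[ext] structure Y2 {X : Type u} [SemilatticeInf X] (p : X) : Type u where
  x : X
  b : Prop
  h : p < x ∨ b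

@[reducible] def lat2 {X : Type u} [SemilatticeInf X] (p : X) : SemilatticeInf (Y2 p) :=
  letI : Min (Y2 p) := ⟨fun s t => ⟨s.x ⊓ t.x, (s.b ∧ t.b) ∨ ¬ p < s.x ⊓ t.x, by tauto⟩⟩
  SemilatticeInf.mk'
    (by
      intro s t
      apply Y2.ext
      · exact inf_comm _ _
      · change ((s.b ∧ t.b) ∨ ¬ p < s.x ⊓ t.x) = ((t.b ∧ s.b) ∨ ¬ p < t.x ⊓ s.x)
        rw [inf_comm, and_comm])
    (by
      intro s t r
      apply Y2.ext
      · exact inf_assoc _ _ _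
      · change ((((s.b ∧ t.b) ∨ ¬ p < s.x ⊓ t.x) ∧ r.b) ∨ ¬ p < s.x ⊓ t.x ⊓ r.x) =
          ((s.b ∧ ((t.b ∧ r.b) ∨ ¬ p < t.x ⊓ r.x)) ∨ ¬ p < s.x ⊓ (t.x ⊓ r.x))
        have h1 : p < s.x ⊓ t.x ⊓ r.x → p < s.x ⊓ t.x := fun h => h.trans_le inf_le_left
        have h2 : p < s.x ⊓ t.x ⊓ r.x → p < t.x ⊓ r.x := fun h => by
          rw [inf_assoc] at h
          exact h.trans_le inf_le_right
        rw [← inf_assoc]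
        apply propext
        tauto)
    (by
      intro s
      apply Y2.ext
      · exact inf_idem _
      · change ((s.b ∧ s.b) ∨ ¬ p < s.x ⊓ s.x) = s.b
        have := s.h
        rw [inf_idem]
        apply propext
        tauto)

def sA {X : Type u} [SemilatticeInf X] {p : X} (W : Set (Y2 p)) : Set X :=
  {x | (⟨x, True, Or.inr trivial⟩ : Y2 p) ∈ W}

def sB {X : Type u} [SemilatticeInf X] {p : X} (W : Set (Y2 p)) : Set X :=
  {x | ∃ h : p < x, (⟨x, False, Or.inl h⟩ : Y2 p) ∈ W}

@[reducible] def top2 {X : Type u} [SemilatticeInf X] [TopologicalSpace X] (p : X)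
    (hU : IsOpen (Ioi p)) (hI : IsOpen (Ici p)) :
    TopologicalSpace (Y2 p) where
  IsOpen W := IsOpen (sA W) ∧ IsOpen (sB W) ∧ ((sB W).Nonempty → insert p (sA W) ∈ 𝓝 p) ∧
    (((sB W).Nonempty ∨ p ∈ sA W) → insert p (sB W) ∈ 𝓝 p)
  isOpen_univ := by
    have h1 : sA (univ : Set (Y2 p)) = univ := by ext; simp [sA]
    have h2 : sB (univ : Set (Y2 p)) = Ioi p := by ext; simp [sB]
    rw [h1, h2, Ioi_insert]
    exact ⟨isOpen_univ, hU, fun _ => by simp, fun _ => hI.mem_nhds self_mem_Ici⟩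
  isOpen_inter := by
    rintro s t ⟨h1, h2, h3, h4⟩ ⟨g1, g2, g3, g4⟩
    have e1 : sA (s ∩ t) = sA s ∩ sA t := rfl
    have e2 : sB (s ∩ t) = sB s ∩ sB t := by
      ext x
      exact ⟨fun ⟨h, a, b⟩ => ⟨⟨h, a⟩, ⟨h, b⟩⟩, fun ⟨⟨h, a⟩, ⟨_, b⟩⟩ => ⟨h, a, b⟩⟩
    rw [e1, e2, insert_inter_distrib, insert_inter_distrib]
    refine ⟨h1.inter g1, h2.inter g2, fun h => Filter.inter_mem (h3 h.left) (g3 h.right),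
      fun h => Filter.inter_mem (h4 (h.imp (fun h => h.left) fun h => h.1))
        (g4 (h.imp (fun h => h.right) fun h => h.2))⟩
  isOpen_sUnion := by
    intro S hS
    have m1 : ∀ t ∈ S, sA t ⊆ sA (⋃₀ S) := fun t ht x hx => ⟨t, ht, hx⟩
    have m2 : ∀ t ∈ S, sB t ⊆ sB (⋃₀ S) := fun t ht x ⟨h, hx⟩ => ⟨h, t, ht, hx⟩
    have e1 : sA (⋃₀ S) = ⋃ t ∈ S, sA t := by ext x; simp [sA]
    have e2 : sB (⋃₀ S) = ⋃ t ∈ S, sB t := by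
      ext x
      simp only [sB, mem_sUnion, mem_ofPred_eq, mem_iUnion]
      tauto
    refine ⟨?_, ?_, ?_, ?_⟩
    · rw [e1]
      exact isOpen_biUnion fun t ht => (hS t ht).1
    · rw [e2]
      exact isOpen_biUnion fun t ht => (hS t ht).2.1
    · rintro ⟨x, h, t, ht, hx⟩
      exact Filter.mem_of_superset ((hS t ht).2.2.1 ⟨x, h, hx⟩) (insert_subset_insert (m1 t ht))
    · rintro (⟨x, h, t, ht, hx⟩ | ⟨t, ht, hx⟩)
      · exact Filter.mem_of_superset ((hS t ht).2.2.2 (Or.inl ⟨x, h, hx⟩))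
          (insert_subset_insert (m2 t ht))
      · exact Filter.mem_of_superset ((hS t ht).2.2.2 (Or.inr hx))
          (insert_subset_insert (m2 t ht))

theorem case2 {X : Type u} [SemilatticeInf X] [TopologicalSpace X] [T1Space X]
    (hsep₁ : ∀ a : X, Continuous fun x : X => a ⊓ x)
    (H : ∀ (Y : Type u) [SemilatticeInf Y] [TopologicalSpace Y] [T1Space Y],
      (∀ a : Y, Continuous fun y : Y => a ⊓ y) →
      (∀ a : Y, Continuous fun y : Y => y ⊓ a) →
      ∀ f : X → Y, (∀ a b : X, f (a ⊓ b) = f a ⊓ f b) → IsEmbedding f →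
        IsClosed (Set.range f))
    (p : X) (hp : ∀ x, p ≤ x ∨ x ≤ p) (hI : IsOpen (Ici p)) (hnp : ¬ IsOpen ({p} : Set X))
    (hirr : ∀ x y : X, p < x → p < y → p < x ⊓ y) : False := by
  have hU : IsOpen (Ioi p) := by
    have : Ioi p = Ici p \ {p} := by simp
    rw [this]
    exact hI.sdiff isClosed_singleton
  have hIc : IsClosed (Ici p) := by
    have : Ici p = (fun x => p ⊓ x) ⁻¹' {p} := by ext x; simp
    rw [this]
    exact isClosed_singleton.preimage (hsep₁ p)
  have hIn : Ici p ∈ 𝓝 p := hI.mem_nhds self_mem_Ici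
  let L2 := lat2 p
  let T2 := top2 p hU hI
  have openiff : ∀ W : Set (Y2 p), IsOpen W ↔ (IsOpen (sA W) ∧ IsOpen (sB W) ∧
    ((sB W).Nonempty → insert p (sA W) ∈ 𝓝 p) ∧
    (((sB W).Nonempty ∨ p ∈ sA W) → insert p (sB W) ∈ 𝓝 p)) := fun W => Iff.rfl
  have infb : ∀ s t : Y2 p, s ⊓ t = ⟨s.x ⊓ t.x, (s.b ∧ t.b) ∨ ¬ p < s.x ⊓ t.x, by tauto⟩ :=
    fun s t => rfl
  have memA : ∀ (W : Set (Y2 p)) (s : Y2 p), s.b → (s ∈ W ↔ s.x ∈ sA W) := by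
    rintro W ⟨x, b, h⟩ hb
    have : b = True := by simpa using hb
    subst this
    rfl
  have memB : ∀ (W : Set (Y2 p)) (s : Y2 p), ¬ s.b → (s ∈ W ↔ s.x ∈ sB W) := by
    rintro W ⟨x, b, h⟩ hb
    have : b = False := by simpa using hb
    subst this
    exact ⟨fun hh => ⟨by simpa using h, hh⟩, fun ⟨_, hh⟩ => hh⟩
  have sBU : ∀ W : Set (Y2 p), sB W ⊆ Ioi p := fun W x h => h.1
  have T : T1Space (Y2 p) := by
    refine ⟨fun z => ?_⟩
    rw [← isOpen_compl_iff, openiff]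
    obtain ⟨z, b, hz⟩ := z
    by_cases hb : b
    · have : b = True := by simpa using hb
      subst this
      have e1 : sA ({⟨z, True, hz⟩}ᶜ : Set (Y2 p)) = {z}ᶜ := by ext x; simp [sA]
      have e2 : sB ({⟨z, True, hz⟩}ᶜ : Set (Y2 p)) = Ioi p := by ext x; simp [sB]
      rw [e1, e2, Ioi_insert]
      refine ⟨isOpen_compl_singleton, hU, fun _ => ?_, fun _ => hIn⟩
      by_cases hzp : z = p
      · subst hzp
        convert Filter.univ_mem
        ext x; simp [em]
      · exact Filter.mem_of_superset (isOpen_compl_singleton.mem_nhds fun h => hzp h.symm)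
          (subset_insert _ _)
    · have : b = False := by simpa using hb
      subst this
      have hz' : p < z := by simpa using hz
      have e1 : sA ({⟨z, False, hz⟩}ᶜ : Set (Y2 p)) = univ := by ext x; simp [sA]
      have e2 : sB ({⟨z, False, hz⟩}ᶜ : Set (Y2 p)) = Ioi p ∩ {z}ᶜ := by ext x; simp [sB]
      rw [e1, e2]
      refine ⟨isOpen_univ, hU.inter isOpen_compl_singleton, fun _ => by simp, fun _ => ?_⟩
      refine Filter.mem_of_superset (Filter.inter_mem hIn
        (isOpen_compl_singleton.mem_nhds fun h => hz'.ne h)) ?_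
      rintro x ⟨hx, hx'⟩
      rcases eq_or_lt_of_le hx with h | h
      · exact Or.inl h.symm
      · exact Or.inr ⟨h, hx'⟩
  have C : ∀ a : Y2 p, Continuous fun y : Y2 p => a ⊓ y := by
    intro a
    refine ⟨fun W hW => ?_⟩
    rw [openiff] at hW ⊢
    obtain ⟨h1, h2, h3, h4⟩ := hW
    obtain ⟨x, b, hx⟩ := a
    -- the second slice of the preimage for `x` above `p`
    have eB : p < x → sB ((fun y : Y2 p => ⟨x, b, hx⟩ ⊓ y) ⁻¹' W)
        = Ioi p ∩ (fun y => x ⊓ y) ⁻¹' (sB W) := by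
      intro hpx
      ext y
      constructor
      · rintro ⟨hy, hyW⟩
        refine ⟨hy, ?_⟩
        rw [mem_preimage, infb, memB _ _ (by simpa using hirr x y hpx hy)] at hyW
        exact hyW
      · rintro ⟨hy, hyW⟩
        refine ⟨hy, ?_⟩
        rw [mem_preimage, infb, memB _ _ (by simpa using hirr x y hpx hy)]
        exact hyW
    have nB : p < x → insert p (sB W) ∈ 𝓝 p →
        insert p (Ioi p ∩ (fun y => x ⊓ y) ⁻¹' (sB W)) ∈ 𝓝 p := by
      intro hpx hn
      have : (fun y => x ⊓ y) ⁻¹' (insert p (sB W)) ∈ 𝓝 p := by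
        apply (hsep₁ x).continuousAt
        simpa [inf_eq_right.2 hpx.le] using hn
      refine Filter.mem_of_superset (Filter.inter_mem hIn this) ?_
      rintro y ⟨hy, hy'⟩
      rcases eq_or_lt_of_le hy with h | h
      · exact Or.inl h.symm
      · refine Or.inr ⟨h, hy'.resolve_left ?_⟩
        exact (hirr x y hpx h).ne'
    by_cases hb : b
    · have : b = True := by simpa using hb
      subst this
      have eA : sA ((fun y : Y2 p => ⟨x, True, hx⟩ ⊓ y) ⁻¹' W) = (fun y => x ⊓ y) ⁻¹' (sA W) := by
        ext y
        change _ ⊓ _ ∈ W ↔ _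
        rw [infb, memA _ _ (by simp)]
        rfl
      by_cases hpx : p < x
      · have hxp : x ⊓ p = p := inf_eq_right.2 hpx.le
        rw [eA, eB hpx]
        refine ⟨h1.preimage (hsep₁ x), hU.inter (h2.preimage (hsep₁ x)), ?_, ?_⟩
        · rintro ⟨y, hy, hy'⟩
          have : (fun y => x ⊓ y) ⁻¹' (insert p (sA W)) ∈ 𝓝 p := by
            apply (hsep₁ x).continuousAt
            simpa [hxp] using h3 ⟨_, hy'⟩
          refine Filter.mem_of_superset (Filter.inter_mem hIn this) ?_
          rintro y ⟨hy, hy'⟩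
          rcases eq_or_lt_of_le hy with h | h
          · exact Or.inl h.symm
          · exact Or.inr (hy'.resolve_left (hirr x y hpx h).ne')
        · intro h
          apply nB hpx
          apply h4
          rcases h with ⟨y, hy, hy'⟩ | h
          · exact Or.inl ⟨_, hy'⟩
          · right
            simpa [hxp] using h
      · have hxp : x ≤ p := (hp x).elim (fun h => by
          rcases eq_or_lt_of_le h with h | h
          · exact h.ge
          · exact absurd h hpx) id
        have hin : ∀ y, p ≤ y → x ⊓ y = x := fun y hy => inf_eq_left.2 (hxp.trans hy)
        have mB : ∀ y, y ∈ sB ((fun y : Y2 p => ⟨x, True, hx⟩ ⊓ y) ⁻¹' W) ↔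
            p < y ∧ x ∈ sA W := by
          intro y
          constructor
          · rintro ⟨hy, hyW⟩
            refine ⟨hy, ?_⟩
            rw [mem_preimage, infb, memA _ _ (by simp [hin y hy.le, hpx])] at hyW
            simpa [hin y hy.le] using hyW
          · rintro ⟨hy, hyW⟩
            refine ⟨hy, ?_⟩
            rw [mem_preimage, infb, memA _ _ (by simp [hin y hy.le, hpx])]
            simpa [hin y hy.le] using hyW
        rw [eA]
        by_cases hxA : x ∈ sA W
        · have eB' : sB ((fun y : Y2 p => ⟨x, True, hx⟩ ⊓ y) ⁻¹' W) = Ioi p := by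
            ext y; rw [mB]; simp [hxA]
          rw [eB', Ioi_insert]
          refine ⟨h1.preimage (hsep₁ x), hU, fun _ => ?_, fun _ => hIn⟩
          refine Filter.mem_of_superset ((h1.preimage (hsep₁ x)).mem_nhds ?_) (subset_insert _ _)
          simpa [hin p le_rfl] using hxA
        · have eB' : sB ((fun y : Y2 p => ⟨x, True, hx⟩ ⊓ y) ⁻¹' W) = ∅ := by
            ext y; rw [mB]; simp [hxA]
          rw [eB']
          refine ⟨h1.preimage (hsep₁ x), isOpen_empty, fun h => by simp at h, fun h => ?_⟩
          simp [hin p le_rfl, hxA] at h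
    · have : b = False := by simpa using hb
      subst this
      have hpx : p < x := by simpa using hx
      have hxp : x ⊓ p = p := inf_eq_right.2 hpx.le
      have mA1 : ∀ y, p < y → (y ∈ sA ((fun y : Y2 p => ⟨x, False, hx⟩ ⊓ y) ⁻¹' W) ↔
          x ⊓ y ∈ sB W) := by
        intro y hy
        change _ ⊓ _ ∈ W ↔ _
        rw [infb, memB _ _ (by simpa using hirr x y hpx hy)]
      have mA2 : ∀ y, y ≤ p → (y ∈ sA ((fun y : Y2 p => ⟨x, False, hx⟩ ⊓ y) ⁻¹' W) ↔
          y ∈ sA W) := by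
        intro y hy
        have hxy : x ⊓ y = y := inf_eq_right.2 (hy.trans hpx.le)
        change _ ⊓ _ ∈ W ↔ _
        rw [infb, memA _ _ (by simpa [hxy] using fun h => absurd hy (not_le_of_gt h))]
        simp [hxy]
      have sub : Ioi p ∩ (fun y => x ⊓ y) ⁻¹' (sB W) ⊆
          sA ((fun y : Y2 p => ⟨x, False, hx⟩ ⊓ y) ⁻¹' W) := fun y hy => (mA1 y hy.1).2 hy.2
      have hopen : IsOpen (Ioi p ∩ (fun y => x ⊓ y) ⁻¹' (sB W)) :=
        hU.inter (h2.preimage (hsep₁ x))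
      rw [eB hpx]
      refine ⟨?_, hopen, ?_, ?_⟩
      · rw [isOpen_iff_mem_nhds]
        intro y hy
        by_cases hpy : p ≤ y
        · rcases eq_or_lt_of_le hpy with h | h
          · subst h
            refine Filter.mem_of_superset (nB hpx (h4 (Or.inr ((mA2 _ le_rfl).1 hy)))) ?_
            exact insert_subset hy sub
          · exact Filter.mem_of_superset (hopen.mem_nhds ⟨h, (mA1 y h).1 hy⟩) sub
        · have hyA := (mA2 y ((hp y).resolve_left hpy)).1 hy
          refine Filter.mem_of_superset ((hIc.isOpen_compl.inter h1).mem_nhds ⟨hpy, hyA⟩) ?_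
          rintro z ⟨hz, hz'⟩
          exact (mA2 z ((hp z).resolve_left hz)).2 hz'
      · rintro ⟨y, hy, hy'⟩
        exact Filter.mem_of_superset (nB hpx (h4 (Or.inl ⟨_, hy'⟩))) (insert_subset_insert sub)
      · intro h
        apply nB hpx
        apply h4
        rcases h with ⟨y, hy, hy'⟩ | h
        · exact Or.inl ⟨_, hy'⟩
        · exact Or.inr ((mA2 _ le_rfl).1 h)
  let f : X → Y2 p := fun x => ⟨x, True, Or.inr trivial⟩
  have finj : Function.Injective f := fun x y h => congrArg Y2.x h
  have E : IsEmbedding f := by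
    refine ⟨⟨?_⟩, finj⟩
    ext V
    rw [isOpen_induced_iff]
    constructor
    · intro hV
      by_cases hpV : p ∈ V
      · refine ⟨{s | s.x ∈ V}, ?_, rfl⟩
        have e1 : sA ({s | s.x ∈ V} : Set (Y2 p)) = V := rfl
        have e2 : sB ({s | s.x ∈ V} : Set (Y2 p)) = Ioi p ∩ V := by ext; simp [sB]
        rw [openiff, e1, e2]
        refine ⟨hV, hU.inter hV, fun _ => Filter.mem_of_superset (hV.mem_nhds hpV)
          (subset_insert _ _), fun _ => ?_⟩
        refine Filter.mem_of_superset (Filter.inter_mem hIn (hV.mem_nhds hpV)) ?_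
        rintro x ⟨hx, hx'⟩
        rcases eq_or_lt_of_le hx with h | h
        · exact Or.inl h.symm
        · exact Or.inr ⟨h, hx'⟩
      · refine ⟨f '' V, ?_, preimage_image_eq _ finj⟩
        have e1 : sA (f '' V) = V := preimage_image_eq _ finj
        have e2 : sB (f '' V) = ∅ := by ext; simp [sB, f]
        rw [openiff, e1, e2]
        exact ⟨hV, isOpen_empty, fun h => by simp at h, fun h => by simp [hpV] at h⟩
    · rintro ⟨W, hW, rfl⟩
      exact hW.1
  have K := H (Y2 p) C (fun a => by simpa only [inf_comm] using C a) f
    (fun a b => by rw [infb]; simp [f]) E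
  rw [← isOpen_compl_iff, openiff] at K
  have e1 : sA (range f)ᶜ = ∅ := by ext; simp [sA, f]
  have e2 : sB (range f)ᶜ = Ioi p := by ext; simp [sB, f]
  rw [e1, e2] at K
  have hne : (Ioi p).Nonempty := by
    by_contra hne
    rw [not_nonempty_iff_eq_empty] at hne
    apply hnp
    have : Ici p = {p} := by rw [← Ioi_insert, hne]; simp
    rwa [← this]
  have := K.2.2.1 hne
  apply hnp
  rw [isOpen_singleton_iff_nhds_eq_pure]
  refine le_antisymm ?_ (pure_le_nhds p)
  simpa using this

/-- If `X` is a `T₁` semitopological semilattice such that every isomorphic topological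
embedding of `X` into a `T₁` semitopological semilattice has closed image, then every
point `p` with `X = ↑p ∪ ↓p` is either isolated or is the meet of two points
different from `p`. -/
theorem stmt14 {X : Type u} [SemilatticeInf X] [TopologicalSpace X] [T1Space X]
    (hsep₁ : ∀ a : X, Continuous fun x : X => a ⊓ x)
    (hsep₂ : ∀ a : X, Continuous fun x : X => x ⊓ a)
    (H : ∀ (Y : Type u) [SemilatticeInf Y] [TopologicalSpace Y] [T1Space Y],
      (∀ a : Y, Continuous fun y : Y => a ⊓ y) →
      (∀ a : Y, Continuous fun y : Y => y ⊓ a) →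
      ∀ f : X → Y, (∀ a b : X, f (a ⊓ b) = f a ⊓ f b) → IsEmbedding f →
        IsClosed (Set.range f)) :
    ∀ p : X, Set.Ici p ∪ Set.Iic p = Set.univ →
      IsOpen ({p} : Set X) ∨ ∃ x y : X, x ≠ p ∧ y ≠ p ∧ x ⊓ y = p := by
  intro p hu
  have hp : ∀ x, p ≤ x ∨ x ≤ p := fun x => by
    have : x ∈ Set.Ici p ∪ Set.Iic p := hu ▸ mem_univ x
    exact this
  by_contra! hcon
  obtain ⟨hnp, hirr⟩ := hcon
  obtain ⟨V, hV, hpV, h1⟩ := case1 hsep₁ H p hp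
  have hI : IsOpen (Ici p) := by
    have : Ici p = (fun x => p ⊓ x) ⁻¹' V := by
      ext x
      constructor
      · intro h
        have h' : p ⊓ x = p := inf_eq_left.2 h
        simpa [h'] using hpV
      · intro h
        have h2 := h1 _ h
        by_contra h3
        exact h2 (lt_of_le_of_ne inf_le_left fun h => h3 (inf_eq_left.1 h))
    rw [this]
    exact hV.preimage (hsep₁ p)
  exact case2 hsep₁ H p hp hI hnp fun x y hx hy =>
    lt_of_le_of_ne (le_inf hx.le hy.le) (hirr x y hx.ne' hy.ne').symm
end

section
/- Let X be a meet-semilattice endowed with the discrete topology. Then X is chain-finite if and only if for every Hausdorff topological semilattice Y and every isomorphic topological embedding f : X → Y, the image f(X) is closed in Y. -/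
open Set Topology

universe u

/-- A semilattice `X` is *chain-finite* if every chain in `X` is finite. -/
def ChainFinite (X : Type*) [SemilatticeInf X] : Prop :=
  ∀ C : Set X, IsChain (· ≤ ·) C → C.Finite

open Filter in
/-- Germs that are constant or given by an `s`-homogeneous sequence. -/
def ExtPred {X : Type u} [SemilatticeInf X] (s : ℕ → X) (r : ℕ → ℕ → Prop)
    (g : Germ (atTop : Filter ℕ) X) : Prop :=
  (∃ c : X, g = Germ.ofFun (fun _ => c)) ∨
    ∃ v : ℕ → X, (∀ n k, r n k → v n ⊓ s k = v k) ∧ g = Germ.ofFun v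

open Filter in
def GermExt {X : Type u} [SemilatticeInf X] (s : ℕ → X) (r : ℕ → ℕ → Prop) : Type u :=
  {g : Germ (atTop : Filter ℕ) X // ExtPred s r g}

namespace GermExt

open Filter

variable {X : Type u} [SemilatticeInf X] {s : ℕ → X} {r : ℕ → ℕ → Prop}

theorem pred_inf {g h : Germ (atTop : Filter ℕ) X} (hg : ExtPred s r g) (hh : ExtPred s r h) :
    ExtPred s r (g ⊓ h) := by
  rcases hg with ⟨c, rfl⟩ | ⟨u, hu, rfl⟩ <;> rcases hh with ⟨d, rfl⟩ | ⟨v, hv, rfl⟩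
  · exact Or.inl ⟨c ⊓ d, rfl⟩
  · exact Or.inr ⟨fun n => c ⊓ v n, fun n k h => by rw [inf_assoc, hv n k h], rfl⟩
  · exact Or.inr ⟨fun n => u n ⊓ d, fun n k h => by
      rw [inf_right_comm, hu n k h], rfl⟩
  · exact Or.inr ⟨fun n => u n ⊓ v n, fun n k h => by
      change u n ⊓ v n ⊓ s k = u k ⊓ v k
      rw [← hu n k h, ← hv n k h, inf_inf_inf_comm, inf_idem], rfl⟩

instance : SemilatticeInf (GermExt s r) :=
  Subtype.semilatticeInf (P := ExtPred s r) (fun _ _ hg hh => pred_inf hg hh)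

/-- The canonical embedding. -/
def emb (s : ℕ → X) (r : ℕ → ℕ → Prop) (c : X) : GermExt s r :=
  ⟨Germ.ofFun (fun _ => c), Or.inl ⟨c, rfl⟩⟩

theorem emb_inf (a b : X) : emb s r (a ⊓ b) = emb s r a ⊓ emb s r b := rfl

theorem emb_inj {a b : X} (h : emb s r a = emb s r b) : a = b := by
  have h1 : (Germ.ofFun (fun _ => a) : Germ (atTop : Filter ℕ) X) = Germ.ofFun (fun _ => b) :=
    congrArg Subtype.val h
  have h2 : ∀ᶠ _ : ℕ in atTop, a = b := Germ.coe_eq.1 h1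
  exact h2.exists.elim fun _ h => h

instance : TopologicalSpace (GermExt s r) where
  IsOpen T := ∀ g ∈ T, Germ.LiftPred (fun x => emb s r x ∈ T) g.1
  isOpen_univ := by
    rintro ⟨g, hg⟩ -
    induction g using Germ.inductionOn
    exact Eventually.of_forall fun _ => mem_univ _
  isOpen_inter := by
    rintro S T hS hT ⟨g, hg⟩ ⟨h1, h2⟩
    have a := hS _ h1
    have b := hT _ h2
    clear h1 h2
    induction g using Germ.inductionOn
    exact Eventually.and a b
  isOpen_sUnion := by
    rintro S hS ⟨g, hg⟩ ⟨T, hT, h1⟩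
    have a := hS T hT _ h1
    clear h1
    induction g using Germ.inductionOn
    exact Eventually.mono a fun x hx => ⟨T, hT, hx⟩

theorem isOpen_def {T : Set (GermExt s r)} :
    IsOpen T ↔ ∀ g ∈ T, Germ.LiftPred (fun x => emb s r x ∈ T) g.1 := Iff.rfl

theorem mem_nhds {g : GermExt s r} {u : ℕ → X} (hu : g.1 = Germ.ofFun u) (T : Set (GermExt s r)) :
    T ∈ 𝓝 g ↔ g ∈ T ∧ ∀ᶠ n in atTop, emb s r (u n) ∈ T := by
  constructor
  · intro h
    obtain ⟨S, hST, hS, hg⟩ := mem_nhds_iff.1 h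
    refine ⟨hST hg, ?_⟩
    have := isOpen_def.1 hS g hg
    rw [hu] at this
    exact Eventually.mono this fun n hn => hST hn
  · rintro ⟨hg, hT⟩
    refine mem_nhds_iff.2 ⟨{z | z ∈ T ∧ (z = g ∨ z ∈ range (emb s r))}, fun z hz => hz.1, ?_,
      hg, Or.inl rfl⟩
    rw [isOpen_def]
    rintro z ⟨hz, rfl | ⟨c, rfl⟩⟩
    · rw [hu]
      exact Eventually.mono hT fun n hn => ⟨hn, Or.inr ⟨_, rfl⟩⟩
    · exact Eventually.of_forall fun n => ⟨hz, Or.inr ⟨_, rfl⟩⟩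

theorem nhds_emb (c : X) : 𝓝 (emb s r c) = pure (emb s r c) := by
  ext T
  rw [mem_nhds (u := fun _ => c) rfl, mem_pure]
  exact ⟨And.left, fun h => ⟨h, Eventually.of_forall fun _ => h⟩⟩

theorem nhds_eq {g : GermExt s r} {u : ℕ → X} (hu : g.1 = Germ.ofFun u) :
    𝓝 g = pure g ⊔ map (fun n => emb s r (u n)) atTop := by
  ext T
  rw [mem_nhds hu]; rfl

theorem cases (g : GermExt s r) : (∃ c, g = emb s r c) ∨
    ((∀ c, g ≠ emb s r c) ∧
      ∃ v : ℕ → X, (∀ n k, r n k → v n ⊓ s k = v k) ∧ g.1 = Germ.ofFun v) := by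
  by_cases h : ∃ c, g = emb s r c
  · exact Or.inl h
  · refine Or.inr ⟨fun c hc => h ⟨c, hc⟩, ?_⟩
    rcases g.2 with ⟨c, hc⟩ | h2
    · exact absurd ⟨c, Subtype.ext hc⟩ h
    · exact h2

def Good (r : ℕ → ℕ → Prop) : Prop := (∀ n m, r n m ↔ n ≤ m) ∨ (∀ n m, r n m ↔ m ≤ n)

theorem key {u v : ℕ → X} (hr : ∀ n, r n n) (hu : ∀ n k, r n k → u n ⊓ s k = u k)
    (hv : ∀ n k, r n k → v n ⊓ s k = v k) {n m : ℕ} (h : r n m) :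
    u n ⊓ v m = u m ⊓ v m := by
  rw [← hv m m (hr m), ← hu n m h, inf_assoc, inf_left_comm (s m), inf_idem]

theorem disj_const (hr : Good r) (g : GermExt s r) (v : ℕ → X)
    (hv : ∀ n k, r n k → v n ⊓ s k = v k) (hg : g.1 = Germ.ofFun v) (c : X)
    (hc : g ≠ emb s r c) : ∀ᶠ n in atTop, v n ≠ c := by
  by_contra hcon
  have hf : ∃ᶠ n in atTop, v n = c := by
    simpa [Filter.Frequently] using hcon
  apply hc
  apply Subtype.ext
  rw [hg]
  apply Germ.coe_eq.2
  rw [frequently_atTop] at hf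
  obtain ⟨n, -, hn⟩ := hf 0
  filter_upwards [eventually_ge_atTop n] with k hk
  obtain ⟨m, hm, hmc⟩ := hf k
  rcases hr with hr | hr
  · rw [← hv n k ((hr _ _).2 hk), hn, ← hmc]
    have h1 := hv n m ((hr _ _).2 (hk.trans hm))
    have h2 := hv n k ((hr _ _).2 hk)
    rw [hn] at h1 h2
    have h3 := hv k m ((hr _ _).2 hm)
    -- `v m = c`, `v n = c`
    have h4 : v k ≤ c := by rw [← h2]; exact inf_le_left
    have h5 : c ≤ v k := by rw [← hmc, ← h3]; exact inf_le_left
    rw [hmc, h2]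
    exact le_antisymm h4 h5
  · have h2 := hv m k ((hr _ _).2 hm)
    have h3 := hv k n ((hr _ _).2 hk)
    rw [hmc] at h2
    rw [hn] at h3
    exact le_antisymm (by rw [← h2]; exact inf_le_left) (by rw [← h3]; exact inf_le_left)

theorem t2 (hr : Good r) : T2Space (GermExt s r) := by
  rw [t2Space_iff_disjoint_nhds]
  have aux : ∀ (c : X) (h : GermExt s r), h ≠ emb s r c → Disjoint (𝓝 (emb s r c)) (𝓝 h) := by
    intro c h hne
    suffices hs : {emb s r c}ᶜ ∈ 𝓝 h from
      Filter.disjoint_of_disjoint_of_mem disjoint_compl_right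
        (by rw [nhds_emb]; exact rfl) hs
    rcases cases h with ⟨d, rfl⟩ | ⟨-, v, hv, hg⟩
    · rw [nhds_emb, mem_pure]
      exact hne
    · rw [mem_nhds hg]
      refine ⟨hne, ?_⟩
      filter_upwards [disj_const hr h v hv hg c hne] with n hn h2
      exact hn (emb_inj h2)
  intro g h hne
  rcases cases g with ⟨c, rfl⟩ | ⟨hgc, u, hu, hgu⟩
  · exact aux c h hne.symm
  rcases cases h with ⟨c, rfl⟩ | ⟨hhc, v, hv, hhv⟩
  · exact (aux c g hne).symm
  have hN : ∃ N, ∀ n ≥ N, ∀ m ≥ N, u n ≠ v m := by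
    by_contra! hcon
    apply hne
    apply Subtype.ext
    rw [hgu, hhv]
    apply Germ.coe_eq.2
    rcases hr with hr | hr
    · obtain ⟨n, -, m, -, hnm⟩ := hcon 0
      filter_upwards [eventually_ge_atTop n, eventually_ge_atTop m] with k h1 h2
      rw [← hu n k ((hr _ _).2 h1), ← hv m k ((hr _ _).2 h2), hnm]
    · refine Eventually.of_forall fun k => ?_
      obtain ⟨n, h1, m, h2, hnm⟩ := hcon k
      rw [← hu n k ((hr _ _).2 h1), ← hv m k ((hr _ _).2 h2), hnm]
  obtain ⟨N, hN⟩ := hN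
  rw [Filter.disjoint_iff]
  refine ⟨{z | z = g ∨ ∃ n ≥ N, z = emb s r (u n)}, ?_,
    {z | z = h ∨ ∃ n ≥ N, z = emb s r (v n)}, ?_, ?_⟩
  · rw [mem_nhds hgu]
    exact ⟨Or.inl rfl, (eventually_ge_atTop N).mono fun n hn => Or.inr ⟨n, hn, rfl⟩⟩
  · rw [mem_nhds hhv]
    exact ⟨Or.inl rfl, (eventually_ge_atTop N).mono fun n hn => Or.inr ⟨n, hn, rfl⟩⟩
  · rw [Set.disjoint_left]
    rintro z (rfl | ⟨n, hn, rfl⟩) (h2 | ⟨m, hm, h2⟩)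
    · exact hne h2
    · exact hgc _ h2
    · exact hhc _ h2.symm
    · exact hN n hn m hm (emb_inj h2)

theorem cont_const (c : X) (h : GermExt s r) (T : Set (GermExt s r)) (hT : T ∈ 𝓝 (emb s r c ⊓ h)) :
    {z | emb s r c ⊓ z ∈ T} ∈ 𝓝 h := by
  obtain ⟨v, hv⟩ : ∃ v, h.1 = Germ.ofFun v := by
    rcases h.2 with ⟨d, hd⟩ | ⟨v, -, hv⟩
    · exact ⟨_, hd⟩
    · exact ⟨v, hv⟩
  have h1 : (emb s r c ⊓ h).1 = Germ.ofFun (fun n => c ⊓ v n) := by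
    change (emb s r c).1 ⊓ h.1 = _
    rw [hv]; rfl
  rw [mem_nhds h1] at hT
  rw [mem_nhds hv]
  exact hT

theorem half (hr : Good r) {g h : GermExt s r} {u v : ℕ → X}
    (hu : ∀ n k, r n k → u n ⊓ s k = u k) (hgu : g.1 = Germ.ofFun u)
    (hv : ∀ n k, r n k → v n ⊓ s k = v k) (hhv : h.1 = Germ.ofFun v) (m : ℕ) :
    g ⊓ emb s r (v m) = g ⊓ h ∨ g ⊓ emb s r (v m) = emb s r (u m ⊓ v m) := by
  have e1 : (g ⊓ emb s r (v m)).1 = Germ.ofFun (fun n => u n ⊓ v m) := by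
    change g.1 ⊓ (emb s r (v m)).1 = _
    rw [hgu]; rfl
  have e2 : (g ⊓ h).1 = Germ.ofFun (fun n => u n ⊓ v n) := by
    change g.1 ⊓ h.1 = _
    rw [hgu, hhv]; rfl
  have hrr : ∀ n, r n n := by
    rcases hr with hr | hr <;> intro n <;> exact (hr _ _).2 le_rfl
  rcases hr with hr | hr
  · left
    apply Subtype.ext
    rw [e1, e2]
    apply Germ.coe_eq.2
    filter_upwards [eventually_ge_atTop m] with n hn
    rw [inf_comm, key hrr hv hu ((hr _ _).2 hn), inf_comm]
  · right
    apply Subtype.ext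
    rw [e1]
    apply Germ.coe_eq.2
    filter_upwards [eventually_ge_atTop m] with n hn
    exact key hrr hu hv ((hr _ _).2 hn)

theorem cont (hr : Good r) : Continuous fun p : GermExt s r × GermExt s r => p.1 ⊓ p.2 := by
  rw [continuous_iff_continuousAt]
  rintro ⟨g, h⟩
  intro T hT
  change T ∈ 𝓝 (g ⊓ h) at hT
  rw [mem_map, nhds_prod_eq, mem_prod_iff]
  rcases cases g with ⟨c, rfl⟩ | ⟨hgc, u, hu, hgu⟩
  · refine ⟨{emb s r c}, by rw [nhds_emb]; exact rfl, _, cont_const c h T hT, ?_⟩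
    rintro ⟨x, y⟩ ⟨rfl, hy⟩
    exact hy
  rcases cases h with ⟨c, rfl⟩ | ⟨hhc, v, hv, hhv⟩
  · rw [inf_comm] at hT
    refine ⟨_, cont_const c g T hT, {emb s r c}, by rw [nhds_emb]; exact rfl, ?_⟩
    rintro ⟨x, y⟩ ⟨hx, rfl⟩
    change x ⊓ emb s r c ∈ T
    rw [inf_comm]
    exact hx
  have e2 : (g ⊓ h).1 = Germ.ofFun (fun n => u n ⊓ v n) := by
    change g.1 ⊓ h.1 = _
    rw [hgu, hhv]; rfl
  rw [mem_nhds e2] at hT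
  obtain ⟨hgh, hT⟩ := hT
  obtain ⟨N, hN⟩ := eventually_atTop.1 hT
  have hrr : ∀ n, r n n := by
    rcases hr with hr | hr <;> intro n <;> exact (hr _ _).2 le_rfl
  have htot : ∀ n m, r n m ∨ r m n := by
    rcases hr with hr | hr <;> intro n m <;> simp only [hr] <;> omega
  refine ⟨{z | z = g ∨ ∃ n ≥ N, z = emb s r (u n)}, ?_,
    {z | z = h ∨ ∃ n ≥ N, z = emb s r (v n)}, ?_, ?_⟩
  · rw [mem_nhds hgu]
    exact ⟨Or.inl rfl, (eventually_ge_atTop N).mono fun n hn => Or.inr ⟨n, hn, rfl⟩⟩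
  · rw [mem_nhds hhv]
    exact ⟨Or.inl rfl, (eventually_ge_atTop N).mono fun n hn => Or.inr ⟨n, hn, rfl⟩⟩
  · rintro ⟨x, y⟩ ⟨hx, hy⟩
    change x ⊓ y ∈ T
    rcases hx with hx | ⟨n, hn, hx⟩ <;> rcases hy with hy | ⟨m, hm, hy⟩ <;>
      simp only at hx hy <;> subst hx <;> subst hy
    · exact hgh
    · rcases half hr hu hgu hv hhv m with h1 | h1 <;> rw [h1]
      · exact hgh
      · exact hN m hm
    · rw [inf_comm]
      rcases half hr hv hhv hu hgu n with h1 | h1 <;> rw [h1, inf_comm]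
      · exact hgh
      · exact hN n hn
    · rw [← emb_inf]
      rcases htot n m with h1 | h1
      · rw [key hrr hu hv h1]
        exact hN m hm
      · rw [inf_comm, key hrr hv hu h1, inf_comm]
        exact hN n hn

theorem isEmbedding [TopologicalSpace X] [DiscreteTopology X] : IsEmbedding (emb s r) := by
  refine (IsOpenEmbedding.of_continuous_injective_isOpenMap continuous_of_discreteTopology
    (fun a b h => emb_inj h) ?_).isEmbedding
  intro U _
  rw [isOpen_iff_mem_nhds]
  rintro _ ⟨c, hc, rfl⟩
  rw [nhds_emb]
  exact ⟨c, hc, rfl⟩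

theorem not_closed (hs : ∀ n k, r n k → s n ⊓ s k = s k) (hinj : Function.Injective s) :
    ¬ IsClosed (range (emb s r)) := by
  intro hcl
  let y : GermExt s r := ⟨Germ.ofFun s, Or.inr ⟨s, hs, rfl⟩⟩
  have hy : y ∈ (range (emb s r))ᶜ := by
    rintro ⟨c, hc⟩
    have h1 : (Germ.ofFun (fun _ => c) : Germ (atTop : Filter ℕ) X) = Germ.ofFun s :=
      congrArg Subtype.val hc
    have h2 : ∀ᶠ n : ℕ in atTop, c = s n := Germ.coe_eq.1 h1
    obtain ⟨N, hN⟩ := eventually_atTop.1 h2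
    have := hinj ((hN N le_rfl).symm.trans (hN (N+1) (by omega)))
    omega
  have h3 := (mem_nhds (g := y) (u := s) rfl _).1 (hcl.isOpen_compl.mem_nhds hy)
  obtain ⟨n, hn⟩ := h3.2.exists
  exact hn ⟨_, rfl⟩

end GermExt

theorem exists_seq_of_not_chainFinite {X : Type u} [SemilatticeInf X] (h : ¬ ChainFinite X) :
    ∃ (s : ℕ → X) (r : ℕ → ℕ → Prop), GermExt.Good r ∧ (∀ n k, r n k → s n ⊓ s k = s k) ∧
      Function.Injective s := by
  unfold ChainFinite at h
  push Not at h
  obtain ⟨C, hC, hinf⟩ := h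
  have : Infinite C := hinf.to_subtype
  let f : ℕ → X := fun n => (Infinite.natEmbedding C n : X)
  have hf : Function.Injective f :=
    Subtype.val_injective.comp (Infinite.natEmbedding C).injective
  obtain ⟨φ, hφ⟩ := exists_increasing_or_nonincreasing_subseq (α := X) (· ≤ ·) f
  have hinj : Function.Injective (fun n => f (φ n)) := hf.comp φ.injective
  rcases hφ with h1 | h1
  · refine ⟨fun n => f (φ n), fun n m => m ≤ n, Or.inr fun _ _ => Iff.rfl, ?_, hinj⟩
    intro n k hk
    apply inf_eq_right.2
    rcases hk.eq_or_lt with rfl | hk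
    · exact le_rfl
    · exact h1 _ _ hk
  · refine ⟨fun n => f (φ n), fun n m => n ≤ m, Or.inl fun _ _ => Iff.rfl, ?_, hinj⟩
    intro n k hk
    apply inf_eq_right.2
    rcases hk.eq_or_lt with rfl | hk
    · exact le_rfl
    · exact (hC.total (Subtype.prop _) (Subtype.prop _)).resolve_left (h1 _ _ hk)

theorem chainFinite_wf {X : Type u} [SemilatticeInf X] (h : ChainFinite X) :
    WellFounded ((· < ·) : X → X → Prop) ∧ WellFounded ((· > ·) : X → X → Prop) := by
  constructor
  · rw [RelEmbedding.wellFounded_iff_isEmpty]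
    refine ⟨fun f => ?_⟩
    have hanti : StrictAnti f := fun a b hab => f.map_rel_iff.2 hab
    refine Set.infinite_range_of_injective hanti.injective (h _ ?_)
    rintro _ ⟨a, rfl⟩ _ ⟨b, rfl⟩ _
    rcases le_total a b with h | h
    · exact Or.inr (hanti.antitone h)
    · exact Or.inl (hanti.antitone h)
  · rw [RelEmbedding.wellFounded_iff_isEmpty]
    refine ⟨fun f => ?_⟩
    have hmono : StrictMono f := fun a b hab => f.map_rel_iff.2 hab
    refine Set.infinite_range_of_injective hmono.injective (h _ ?_)
    rintro _ ⟨a, rfl⟩ _ ⟨b, rfl⟩ _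
    rcases le_total a b with h | h
    · exact Or.inl (hmono.monotone h)
    · exact Or.inr (hmono.monotone h)

theorem closed_of_chainFinite {X : Type u} [SemilatticeInf X] [TopologicalSpace X]
    [DiscreteTopology X] (hX : ChainFinite X) (Y : Type u) [SemilatticeInf Y]
    [TopologicalSpace Y] [T2Space Y] (hc : Continuous fun p : Y × Y => p.1 ⊓ p.2)
    (f : X → Y) (hf : ∀ a b : X, f (a ⊓ b) = f a ⊓ f b) (he : IsEmbedding f) :
    IsClosed (Set.range f) := by
  obtain ⟨wf1, wf2⟩ := chainFinite_wf hX
  have hcl : ∀ a : Y, Continuous fun x : Y => a ⊓ x := fun a =>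
    hc.comp (continuous_const.prodMk continuous_id)
  rw [← closure_subset_iff_isClosed]
  intro y hy
  by_contra hyr
  -- existence of points of `X` near `y`
  have hex : ∀ V : Set Y, IsOpen V → y ∈ V → ∃ x, f x ∈ V := by
    intro V hV hyV
    obtain ⟨_, h1, x, rfl⟩ := mem_closure_iff.1 hy V hV hyV
    exact ⟨x, h1⟩
  have hdown : ∀ U : Set Y, IsOpen U → ∀ p : X, f p ⊓ y ∈ U →
      ∃ q : X, f q ∈ U ∧ f q ≤ y := by
    intro U hU p
    refine wf1.induction (C := fun p => f p ⊓ y ∈ U → ∃ q : X, f q ∈ U ∧ f q ≤ y) p ?_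
    · intro p ih
      intro hp
      by_cases h : ∃ x : X, p ⊓ x < p ∧ f (p ⊓ x) ⊓ y ∈ U
      · obtain ⟨x, hx, hxU⟩ := h
        exact ih _ hx hxU
      · push Not at h
        have hfp : f p ⊓ y = f p := by
          by_contra hne
          let V : Set Y := {x | f p ⊓ x ⊓ y ∈ U} ∩ {x | f p ⊓ x ≠ f p}
          have hV : IsOpen V := by
            refine (hU.preimage (hc.comp ((hcl (f p)).prodMk continuous_const))).inter ?_
            exact isOpen_ne.preimage (hcl (f p))
          obtain ⟨x, hx1, hx2⟩ := hex V hV ⟨by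
            change f p ⊓ y ⊓ y ∈ U
            rwa [inf_assoc, inf_idem], hne⟩
          refine h x (lt_of_le_of_ne inf_le_left fun h3 => hx2 ?_) ?_
          · rw [← hf, h3]
          · rw [hf]; exact hx1
        exact ⟨p, hfp ▸ hp, inf_eq_left.1 hfp⟩
  have hdown' : ∀ U : Set Y, IsOpen U → y ∈ U → ∃ q : X, f q ∈ U ∧ f q ≤ y := by
    intro U hU hyU
    obtain ⟨x, hx⟩ := hex {x | x ⊓ y ∈ U} (hU.preimage
      (hc.comp (continuous_id.prodMk continuous_const))) (by
        change y ⊓ y ∈ U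
        rwa [inf_idem])
    exact hdown U hU x hx
  obtain ⟨q0, -, hq0⟩ := hdown' univ isOpen_univ (mem_univ _)
  obtain ⟨p, hp, hmax⟩ := wf2.has_min {q : X | f q ≤ y} ⟨q0, hq0⟩
  obtain ⟨W, hW, hWp⟩ := he.isInducing.isOpen_iff.1 (isOpen_discrete ({p} : Set X))
  have hpW : f p ∈ W := by
    have : p ∈ f ⁻¹' W := by rw [hWp]; rfl
    exact this
  obtain ⟨q, ⟨hq1, hq2⟩, hqy⟩ := hdown' ({x | f p ⊓ x ∈ W} ∩ {x | x ≠ f p})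
    ((hW.preimage (hcl (f p))).inter isOpen_ne) ⟨by
      change f p ⊓ y ∈ W
      rwa [inf_eq_left.2 hp], fun h => hyr ⟨p, h.symm⟩⟩
  have h5 : p ⊓ q ∈ f ⁻¹' W := by
    change f (p ⊓ q) ∈ W
    rw [hf]; exact hq1
  rw [hWp] at h5
  have h6 : p ≤ q := inf_eq_left.1 h5
  exact hmax q hqy (lt_of_le_of_ne h6 fun h => hq2 (by rw [h]))

/-- A discrete topological semilattice `X` is chain-finite if and only if every
isomorphic topological embedding of `X` into a Hausdorff topological semilattice
has closed image. -/
theorem stmt15 {X : Type u} [SemilatticeInf X] [TopologicalSpace X] [DiscreteTopology X] :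
    ChainFinite X ↔
      ∀ (Y : Type u) [SemilatticeInf Y] [TopologicalSpace Y] [T2Space Y],
        (Continuous fun p : Y × Y => p.1 ⊓ p.2) →
        ∀ f : X → Y, (∀ a b : X, f (a ⊓ b) = f a ⊓ f b) → IsEmbedding f →
          IsClosed (Set.range f) := by
  constructor
  · intro hX Y _ _ _ hc f hf he
    exact closed_of_chainFinite hX Y hc f hf he
  · intro h
    by_contra hX
    obtain ⟨s, r, hr, hs, hinj⟩ := exists_seq_of_not_chainFinite hX
    haveI := GermExt.t2 (s := s) hr
    exact GermExt.not_closed hs hinj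
      (h (GermExt s r) (GermExt.cont hr) (GermExt.emb s r) GermExt.emb_inf GermExt.isEmbedding)
end

section
/- Let X be a linear Hausdorff topological semilattice, i.e., a Hausdorff topological semilattice in which x ⊓ y ∈ {x, y} for all x, y ∈ X. Then the following are equivalent: (1) for every continuous homomorphism h : X → Y into a Hausdorff topological semigroup Y (h(a ⊓ b) = h(a)·h(b)), the image h(X) is closed in Y; (2) for every isomorphic topological embedding f : X → Y into a Hausdorff topological semigroup Y, the image f(X) is closed in Y; (3) every nonempty subset C ⊆ X has a greatest lower bound inf C belonging to the closure of ↑C = ⋃_{c∈C} ↑c, and a least upper bound sup C belonging to the closure of ↓C = ⋃_{c∈C} ↓c. -/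
open Set Topology

universe u


open Filter

section helpers

variable {X : Type u} [SemilatticeInf X] [TopologicalSpace X] [T2Space X]

/-- Extension topology on `Option X`, with neighbourhoods of `none` given by a filter. -/
def extTop (F : Filter X) : TopologicalSpace (Option X) where
  IsOpen V := IsOpen (some ⁻¹' V) ∧ (none ∈ V → some ⁻¹' V ∈ F)
  isOpen_univ := by simp
  isOpen_inter := by
    rintro s t ⟨h1, h2⟩ ⟨h3, h4⟩
    exact ⟨h1.inter h3, fun h => inter_mem (h2 h.1) (h4 h.2)⟩
  isOpen_sUnion := by
    intro s hs
    refine ⟨?_, ?_⟩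
    · rw [preimage_sUnion]
      exact isOpen_biUnion fun t ht => (hs t ht).1
    · rintro ⟨t, ht, hn⟩
      exact mem_of_superset ((hs t ht).2 hn) fun x hx => ⟨t, ht, hx⟩

omit [SemilatticeInf X] [T2Space X] in
theorem extTop_nhds_some (F : Filter X) (x : X) :
    @nhds (Option X) (extTop F) (some x) = map some (𝓝 x) := by
  letI := extTop F
  ext s
  rw [mem_map, mem_nhds_iff, mem_nhds_iff]
  constructor
  · rintro ⟨t, hts, ht, hx⟩
    exact ⟨some ⁻¹' t, preimage_mono hts, ht.1, hx⟩
  · rintro ⟨t, hts, ht, hx⟩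
    refine ⟨some '' t, by rintro _ ⟨y, hy, rfl⟩; exact hts hy, ⟨?_, ?_⟩, ⟨x, hx, rfl⟩⟩
    · rwa [preimage_image_eq _ (Option.some_injective X)]
    · rintro ⟨y, _, hy⟩
      cases hy

omit [SemilatticeInf X] [T2Space X] in
theorem extTop_nhds_none (F : Filter X) (hF : ∀ S ∈ F, ∃ T ∈ F, IsOpen T ∧ T ⊆ S) :
    @nhds (Option X) (extTop F) none = pure none ⊔ map some F := by
  letI := extTop F
  ext s
  rw [mem_sup, mem_map, mem_nhds_iff, mem_pure]
  constructor
  · rintro ⟨t, hts, ht, hx⟩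
    exact ⟨hts hx, mem_of_superset (ht.2 hx) (preimage_mono hts)⟩
  · rintro ⟨h1, h2⟩
    obtain ⟨T, hT, hTo, hTs⟩ := hF _ h2
    have e : some ⁻¹' (insert none (some '' T)) = T := by
      ext z; simp
    refine ⟨insert none (some '' T), ?_, ⟨?_, ?_⟩, mem_insert _ _⟩
    · rintro _ (rfl | ⟨y, hy, rfl⟩)
      · exact h1
      · exact hTs hy
    · rwa [e]
    · intro _
      rwa [e]

open Classical in
/-- Multiplication on `Option X` with `none` inserted just below the upper set `U`. -/
noncomputable def extMul (U : Set X) : Option X → Option X → Option X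
  | none, none => none
  | none, some x => if x ∈ U then none else some x
  | some x, none => if x ∈ U then none else some x
  | some x, some y => some (x ⊓ y)

omit [TopologicalSpace X] [T2Space X] in
theorem extMul_assoc (U : Set X) (hup : IsUpperSet U) (hLU : ∀ x ∈ U, ∀ y ∉ U, y ≤ x)
    (hlin : ∀ x y : X, x ⊓ y = x ∨ x ⊓ y = y) (a b c : Option X) :
    extMul U (extMul U a b) c = extMul U a (extMul U b c) := by
  have h1 : ∀ x y, x ⊓ y ∈ U ↔ x ∈ U ∧ y ∈ U := by
    intro x y
    constructor
    · intro h
      exact ⟨hup inf_le_left h, hup inf_le_right h⟩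
    · rintro ⟨h, h'⟩
      rcases hlin x y with e | e <;> rwa [e]
  have h2 : ∀ x ∈ U, ∀ y ∉ U, x ⊓ y = y := fun x hx y hy => inf_eq_right.2 (hLU x hx y hy)
  have h3 : ∀ x ∈ U, ∀ y ∉ U, y ⊓ x = y := fun x hx y hy => inf_eq_left.2 (hLU x hx y hy)
  rcases a with _ | x <;> rcases b with _ | y <;> rcases c with _ | z <;>
    simp only [extMul, inf_assoc] <;>
    (try by_cases hx : x ∈ U) <;> (try by_cases hy : y ∈ U) <;> (try by_cases hz : z ∈ U) <;>
    simp [extMul, *]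

theorem ext_key (hXcont : Continuous fun p : X × X => p.1 ⊓ p.2)
    (hlin : ∀ x y : X, x ⊓ y = x ∨ x ⊓ y = y)
    (U : Set X) (hU : IsClopen U) (hup : IsUpperSet U)
    (F : Filter X) [F.NeBot] (hF : ∀ S ∈ F, ∃ T ∈ F, IsOpen T ∧ T ⊆ S)
    (HU : ∀ x ∈ U, ∀ᶠ p in F ×ˢ 𝓝 x, p.1 < p.2)
    (HL : ∀ x ∉ U, ∀ᶠ p in F ×ˢ 𝓝 x, p.2 < p.1)
    (h2 : ∀ (Y : Type u) [Semigroup Y] [TopologicalSpace Y] [T2Space Y],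
        (Continuous fun p : Y × Y => p.1 * p.2) →
        ∀ f : X → Y, (∀ a b : X, f (a ⊓ b) = f a * f b) → IsEmbedding f →
          IsClosed (Set.range f)) : False := by
  have hLU : ∀ x ∈ U, ∀ y ∉ U, y ≤ x := by
    intro x hx y hy
    rcases hlin x y with e | e
    · exact absurd (hup (inf_eq_left.1 e) hx) hy
    · exact inf_eq_right.1 e
  letI : Semigroup (Option X) :=
    { mul := extMul U, mul_assoc := extMul_assoc U hup hLU hlin }
  letI : TopologicalSpace (Option X) := extTop F
  have ns : ∀ x : X, 𝓝 (some x) = map some (𝓝 x) := extTop_nhds_some F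
  have nn : 𝓝 (none : Option X) = pure none ⊔ map some F := extTop_nhds_none F hF
  have hdisj : ∀ x, Disjoint F (𝓝 x) := by
    intro x
    have : ∀ᶠ p in F ×ˢ 𝓝 x, p.1 ≠ p.2 := by
      by_cases hx : x ∈ U
      · exact (HU x hx).mono fun p h => h.ne
      · exact (HL x hx).mono fun p h => h.ne'
    obtain ⟨P, hP, Q, hQ, h⟩ := eventually_prod_iff.1 this
    rw [Filter.disjoint_iff]
    refine ⟨_, hP, _, hQ, ?_⟩
    rw [Set.disjoint_left]
    intro z hz hz'
    exact h hz hz' rfl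
  have dn : ∀ x : X, Disjoint (𝓝 (none : Option X)) (𝓝 (some x)) := by
    intro x
    rw [nn, ns, disjoint_sup_left]
    refine ⟨?_, (disjoint_map (Option.some_injective X)).2 (hdisj x)⟩
    rw [Filter.disjoint_iff]
    refine ⟨{none}, by simp, range some, range_mem_map, ?_⟩
    rw [Set.disjoint_left]
    rintro _ rfl ⟨y, hy⟩
    cases hy
  haveI : T2Space (Option X) := by
    rw [t2Space_iff_disjoint_nhds]
    rintro (_ | x) (_ | y) hxy
    · exact absurd rfl hxy
    · exact dn y
    · exact (dn x).symm
    · rw [ns, ns]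
      refine (disjoint_map (Option.some_injective X)).2 (disjoint_nhds_nhds.2 ?_)
      rintro rfl
      exact hxy rfl
  have m1 : (none : Option X) * none = none := rfl
  have m2 : ∀ x ∈ U, (none : Option X) * some x = none := fun x hx => if_pos hx
  have m3 : ∀ x ∉ U, (none : Option X) * some x = some x := fun x hx => if_neg hx
  have m4 : ∀ x y : X, (some x : Option X) * some y = some (x ⊓ y) := fun _ _ => rfl
  have mc : ∀ a b : Option X, a * b = b * a := by
    rintro (_ | x) (_ | y)
    · rfl
    · rfl
    · rfl
    · rw [m4, m4, inf_comm]
  have cns : ∀ x : X, Tendsto (fun p : Option X × Option X => p.1 * p.2)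
      (𝓝 none ×ˢ 𝓝 (some x)) (𝓝 (none * some x)) := by
    intro x
    rw [nn, ns, sup_prod, tendsto_sup, pure_prod, prod_map_map_eq,
      tendsto_map'_iff, tendsto_map'_iff, tendsto_map'_iff]
    by_cases hx : x ∈ U
    · rw [m2 x hx, nn]
      constructor
      · refine (tendsto_pure.2 ?_ : Tendsto _ _ (pure none)).mono_right le_sup_left
        filter_upwards [hU.isOpen.mem_nhds hx] with p hp
        exact m2 _ hp
      · refine Tendsto.mono_right ?_ (le_sup_right : map some F ≤ _)
        refine Tendsto.congr' ?_ (tendsto_map.comp tendsto_fst)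
        filter_upwards [HU x hx] with p hp
        exact congrArg some (inf_eq_left.2 hp.le).symm
    · rw [m3 x hx, ns]
      constructor
      · refine Tendsto.congr' ?_ tendsto_map
        filter_upwards [hU.compl.isOpen.mem_nhds hx] with p hp
        exact (m3 _ hp).symm
      · refine Tendsto.congr' ?_ (tendsto_map.comp tendsto_snd)
        filter_upwards [HL x hx] with p hp
        exact congrArg some (inf_eq_right.2 hp.le).symm
  have hcont : Continuous fun p : Option X × Option X => p.1 * p.2 := by
    rw [continuous_iff_continuousAt]
    rintro ⟨_ | x, _ | y⟩
    · rw [ContinuousAt, nhds_prod_eq]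
      change Tendsto _ _ (𝓝 none)
      intro S hS
      rw [nn, mem_sup, mem_map, mem_pure] at hS
      have hT : insert none (some '' (some ⁻¹' S)) ∈ 𝓝 (none : Option X) := by
        rw [nn, mem_sup, mem_map, mem_pure]
        refine ⟨mem_insert _ _, mem_of_superset hS.2 fun z hz => Or.inr ⟨z, hz, rfl⟩⟩
      refine mem_map.2 (mem_of_superset (prod_mem_prod hT hT) ?_)
      have hn : ∀ z, some z ∈ S → none * some z ∈ S := by
        intro z hz
        by_cases h : z ∈ U
        · rw [m2 z h]; exact hS.1
        · rw [m3 z h]; exact hz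
      rintro ⟨_, _⟩ ⟨rfl | ⟨a, ha, rfl⟩, rfl | ⟨b, hb, rfl⟩⟩
      · exact hS.1
      · exact hn b hb
      · change some a * none ∈ S
        rw [mc]; exact hn a ha
      · change some (a ⊓ b) ∈ S
        rcases hlin a b with e | e <;> rw [e]
        · exact ha
        · exact hb
    · rw [ContinuousAt, nhds_prod_eq]
      exact cns y
    · rw [ContinuousAt, nhds_prod_eq]
      change Tendsto _ _ (𝓝 (some x * none))
      rw [mc, prod_comm, tendsto_map'_iff]
      refine (cns x).congr fun p => ?_
      exact mc _ _
    · rw [ContinuousAt, nhds_prod_eq, ns, ns, prod_map_map_eq, tendsto_map'_iff]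
      change Tendsto _ _ (𝓝 (some (x ⊓ y)))
      rw [ns]
      have := hXcont.tendsto (x, y)
      rw [nhds_prod_eq] at this
      exact tendsto_map.comp this
  have hemb : IsEmbedding (some : X → Option X) := by
    refine ⟨isInducing_iff_nhds.2 fun x => ?_, Option.some_injective X⟩
    rw [ns, comap_map (Option.some_injective X)]
  have hcl := h2 (Option X) hcont some (fun _ _ => rfl) hemb
  have : (none : Option X) ∈ closure (range some) := by
    rw [mem_closure_iff_clusterPt, ClusterPt, nn]
    refine NeBot.mono (inferInstance : NeBot (map some F)) ?_
    exact le_inf le_sup_right (le_principal_iff.2 range_mem_map)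
  rw [hcl.closure_eq] at this
  obtain ⟨y, hy⟩ := this
  cases hy

theorem closed_Iic (hXcont : Continuous fun p : X × X => p.1 ⊓ p.2) (c : X) :
    IsClosed (Iic c) := by
  have : Iic c = {x | x ⊓ c = x} := by ext x; simp
  rw [this]
  exact isClosed_eq (hXcont.comp (continuous_id.prodMk continuous_const)) continuous_id

theorem closed_Ici (hXcont : Continuous fun p : X × X => p.1 ⊓ p.2) (c : X) :
    IsClosed (Ici c) := by
  have : Ici c = {x | x ⊓ c = c} := by ext x; simp
  rw [this]
  exact isClosed_eq (hXcont.comp (continuous_id.prodMk continuous_const)) continuous_const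

theorem two_three (hXcont : Continuous fun p : X × X => p.1 ⊓ p.2)
    (hlin : ∀ x y : X, x ⊓ y = x ∨ x ⊓ y = y)
    (h2 : ∀ (Y : Type u) [Semigroup Y] [TopologicalSpace Y] [T2Space Y],
        (Continuous fun p : Y × Y => p.1 * p.2) →
        ∀ f : X → Y, (∀ a b : X, f (a ⊓ b) = f a * f b) → IsEmbedding f →
          IsClosed (Set.range f)) (C : Set X) (hC : C.Nonempty) :
    (∃ a, IsGLB C a ∧ a ∈ closure (⋃ c ∈ C, Set.Ici c)) ∧
        (∃ b, IsLUB C b ∧ b ∈ closure (⋃ c ∈ C, Set.Iic c)) := by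
  have tot : ∀ x y : X, x ≤ y ∨ y ≤ x := fun x y =>
    (hlin x y).imp inf_eq_left.1 inf_eq_right.1
  have nle : ∀ x y : X, ¬ x ≤ y ↔ y < x := fun x y =>
    ⟨fun h => lt_of_le_not_ge ((tot x y).resolve_left h) h, fun h => h.not_ge⟩
  have oIio : ∀ c : X, IsOpen (Iio c) := by
    intro c
    have : Iio c = (Ici c)ᶜ := by ext x; simp [nle]
    rw [this]; exact (closed_Ici hXcont c).isOpen_compl
  have oIoi : ∀ c : X, IsOpen (Ioi c) := by
    intro c
    have : Ioi c = (Iic c)ᶜ := by ext x; simp [nle]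
    rw [this]; exact (closed_Iic hXcont c).isOpen_compl
  haveI : Nonempty C := hC.to_subtype
  constructor
  · by_contra hno
    set U : Set X := ⋃ c ∈ C, Set.Ici c with hUdef
    have memU : ∀ x, x ∈ U ↔ ∃ c ∈ C, c ≤ x := by intro x; simp [hUdef]
    have hmin : ∀ c ∈ C, ∃ d ∈ C, d < c := by
      intro c hc
      by_contra hcon
      push Not at hcon
      refine hno ⟨c, ⟨fun d hd => ?_, fun z hz => hz hc⟩, subset_closure ((memU c).2 ⟨c, hc, le_rfl⟩)⟩
      by_contra h
      exact hcon d hd ((nle _ _).1 h)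
    have hminU : ∀ x ∈ U, ∃ d ∈ C, d < x := by
      intro x hx
      obtain ⟨c, hc, hcx⟩ := (memU x).1 hx
      obtain ⟨d, hd, hdc⟩ := hmin c hc
      exact ⟨d, hd, hdc.trans_le hcx⟩
    have hUo : IsOpen U := by
      have : U = ⋃ c ∈ C, Ioi c := by
        ext x
        simp only [mem_iUnion, mem_Ioi, exists_prop]
        exact ⟨hminU x, fun ⟨d, hd, h⟩ => (memU x).2 ⟨d, hd, h.le⟩⟩
      rw [this]
      exact isOpen_biUnion fun c _ => oIoi c
    have hUc : IsClosed U := by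
      rw [← closure_subset_iff_isClosed]
      intro x hx
      by_contra hxU
      refine hno ⟨x, ⟨fun c hc => ?_, fun z hz => ?_⟩, hx⟩
      · by_contra h
        exact hxU ((memU x).2 ⟨c, hc, ((nle _ _).1 h).le⟩)
      · have : U ⊆ Ici z := by
          intro w hw
          obtain ⟨c, hc, hcw⟩ := (memU w).1 hw
          exact (hz hc).trans hcw
        exact closure_minimal this (closed_Ici hXcont z) hx
    have hup : IsUpperSet U := by
      intro x y hxy hx
      obtain ⟨c, hc, hcx⟩ := (memU x).1 hx
      exact (memU y).2 ⟨c, hc, hcx.trans hxy⟩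
    let F : Filter X := ⨅ c : C, 𝓟 (U ∩ Iio c.1)
    have hb : F.HasBasis (fun _ : C => True) fun c => U ∩ Iio c.1 := by
      refine hasBasis_iInf_principal ?_
      intro c d
      rcases tot c.1 d.1 with h | h
      · exact ⟨c, Subset.rfl, inter_subset_inter_right _ (Iio_subset_Iio h)⟩
      · exact ⟨d, inter_subset_inter_right _ (Iio_subset_Iio h), Subset.rfl⟩
    have hne : F.NeBot := by
      refine hb.neBot_iff.2 ?_
      intro c _
      obtain ⟨d, hd, hdc⟩ := hmin c.1 c.2
      exact ⟨d, (memU d).2 ⟨d, hd, le_rfl⟩, hdc⟩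
    refine ext_key hXcont hlin U ⟨hUc, hUo⟩ hup F ?_ ?_ ?_ h2
    · intro S hS
      obtain ⟨c, _, hc⟩ := hb.mem_iff.1 hS
      exact ⟨_, hb.mem_of_mem (i := c) trivial, hUo.inter (oIio _), hc⟩
    · intro x hx
      obtain ⟨d, hd, hdx⟩ := hminU x hx
      filter_upwards [prod_mem_prod (hb.mem_of_mem (i := ⟨d, hd⟩) trivial)
        ((oIoi d).mem_nhds hdx)] with p hp
      exact hp.1.2.trans hp.2
    · intro x hx
      obtain ⟨c, hc⟩ := hC
      filter_upwards [prod_mem_prod (hb.mem_of_mem (i := ⟨c, hc⟩) trivial)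
        (hUc.isOpen_compl.mem_nhds hx)] with p hp
      rw [← nle]
      intro h
      exact hp.2 (hup h hp.1.1)
  · by_contra hno
    set L : Set X := ⋃ c ∈ C, Set.Iic c with hLdef
    have memL : ∀ x, x ∈ L ↔ ∃ c ∈ C, x ≤ c := by intro x; simp [hLdef]
    have hmax : ∀ c ∈ C, ∃ d ∈ C, c < d := by
      intro c hc
      by_contra hcon
      push Not at hcon
      refine hno ⟨c, ⟨fun d hd => ?_, fun z hz => hz hc⟩, subset_closure ((memL c).2 ⟨c, hc, le_rfl⟩)⟩
      by_contra h
      exact hcon d hd ((nle _ _).1 h)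
    have hmaxL : ∀ x ∈ L, ∃ d ∈ C, x < d := by
      intro x hx
      obtain ⟨c, hc, hcx⟩ := (memL x).1 hx
      obtain ⟨d, hd, hdc⟩ := hmax c hc
      exact ⟨d, hd, hcx.trans_lt hdc⟩
    have hLo : IsOpen L := by
      have : L = ⋃ c ∈ C, Iio c := by
        ext x
        simp only [mem_iUnion, mem_Iio, exists_prop]
        exact ⟨hmaxL x, fun ⟨d, hd, h⟩ => (memL x).2 ⟨d, hd, h.le⟩⟩
      rw [this]
      exact isOpen_biUnion fun c _ => oIio c
    have hLc : IsClosed L := by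
      rw [← closure_subset_iff_isClosed]
      intro x hx
      by_contra hxL
      refine hno ⟨x, ⟨fun c hc => ?_, fun z hz => ?_⟩, hx⟩
      · by_contra h
        exact hxL ((memL x).2 ⟨c, hc, ((nle _ _).1 h).le⟩)
      · have : L ⊆ Iic z := by
          intro w hw
          obtain ⟨c, hc, hcw⟩ := (memL w).1 hw
          exact hcw.trans (hz hc)
        exact closure_minimal this (closed_Iic hXcont z) hx
    have hlow : IsLowerSet L := by
      intro x y hxy hx
      obtain ⟨c, hc, hcx⟩ := (memL x).1 hx
      exact (memL y).2 ⟨c, hc, hxy.trans hcx⟩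
    let F : Filter X := ⨅ c : C, 𝓟 (L ∩ Ioi c.1)
    have hb : F.HasBasis (fun _ : C => True) fun c => L ∩ Ioi c.1 := by
      refine hasBasis_iInf_principal ?_
      intro c d
      rcases tot c.1 d.1 with h | h
      · exact ⟨d, inter_subset_inter_right _ (Ioi_subset_Ioi h), Subset.rfl⟩
      · exact ⟨c, Subset.rfl, inter_subset_inter_right _ (Ioi_subset_Ioi h)⟩
    have hne : F.NeBot := by
      refine hb.neBot_iff.2 ?_
      intro c _
      obtain ⟨d, hd, hdc⟩ := hmax c.1 c.2
      exact ⟨d, (memL d).2 ⟨d, hd, le_rfl⟩, hdc⟩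
    refine ext_key hXcont hlin Lᶜ (IsClopen.compl ⟨hLc, hLo⟩) hlow.compl F ?_ ?_ ?_ h2
    · intro S hS
      obtain ⟨c, _, hc⟩ := hb.mem_iff.1 hS
      exact ⟨_, hb.mem_of_mem (i := c) trivial, hLo.inter (oIoi _), hc⟩
    · intro x hx
      obtain ⟨c, hc⟩ := hC
      filter_upwards [prod_mem_prod (hb.mem_of_mem (i := ⟨c, hc⟩) trivial)
        (hLc.isOpen_compl.mem_nhds hx)] with p hp
      rw [← nle]
      intro h
      exact hp.2 (hlow h hp.1.1)
    · intro x hx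
      obtain ⟨d, hd, hdx⟩ := hmaxL x (not_not.1 hx)
      filter_upwards [prod_mem_prod (hb.mem_of_mem (i := ⟨d, hd⟩) trivial)
        ((oIio d).mem_nhds hdx)] with p hp
      exact lt_trans hp.2 hp.1.2

omit [T2Space X] in
theorem three_one (hlin : ∀ x y : X, x ⊓ y = x ∨ x ⊓ y = y)
    (h3 : ∀ C : Set X, C.Nonempty →
        (∃ a, IsGLB C a ∧ a ∈ closure (⋃ c ∈ C, Set.Ici c)) ∧
        (∃ b, IsLUB C b ∧ b ∈ closure (⋃ c ∈ C, Set.Iic c)))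
    (Y : Type u) [Semigroup Y] [TopologicalSpace Y] [T2Space Y]
    (hY : Continuous fun p : Y × Y => p.1 * p.2)
    (h : X → Y) (hc : Continuous h) (hm : ∀ a b : X, h (a ⊓ b) = h a * h b) :
    IsClosed (Set.range h) := by
  rw [← closure_subset_iff_isClosed]
  intro y hy
  by_contra hyn
  have rm : ∀ e : Y, Continuous fun z => z * e := fun e =>
    hY.comp (continuous_id.prodMk continuous_const)
  have lm : ∀ e : Y, Continuous fun z => e * z := fun e =>
    hY.comp (continuous_const.prodMk continuous_id)
  let A : Set X := {x | y * h x = h x}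
  let B : Set X := {x | y * h x = y}
  have hAB : ∀ x, x ∈ A ∨ x ∈ B := by
    intro x
    have hcl : IsClosed ({z | z * h x = h x} ∪ {z | z * h x = z}) :=
      (isClosed_eq (rm _) continuous_const).union (isClosed_eq (rm _) continuous_id)
    refine closure_minimal ?_ hcl hy
    rintro _ ⟨a, rfl⟩
    rcases hlin a x with e | e
    · right; change h a * h x = h a; rw [← hm, e]
    · left; change h a * h x = h x; rw [← hm, e]
  have hAc : IsClosed A := isClosed_eq ((lm y).comp hc) hc
  have hBc : IsClosed B := isClosed_eq ((lm y).comp hc) continuous_const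
  have hdis : ∀ x, x ∈ A → x ∈ B → False := fun x ha hb => hyn ⟨x, ha.symm.trans hb⟩
  have hAl : (⋃ c ∈ A, Iic c) ⊆ A := by
    intro x hx
    simp only [mem_iUnion, mem_Iic, exists_prop] at hx
    obtain ⟨c, hcA, hxc⟩ := hx
    have e : h x = h c * h x := by rw [← hm, inf_eq_right.2 hxc]
    change y * h x = h x
    rw [e, ← mul_assoc, show y * h c = h c from hcA]
  have hBu : (⋃ c ∈ B, Ici c) ⊆ B := by
    intro x hx
    simp only [mem_iUnion, mem_Ici, exists_prop] at hx
    obtain ⟨c, hcB, hxc⟩ := hx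
    have e : h c * h x = h c := by rw [← hm, inf_eq_left.2 hxc]
    have hcB' : y * h c = y := hcB
    change y * h x = y
    calc y * h x = y * h c * h x := by rw [hcB']
      _ = y := by rw [mul_assoc, e, hcB']
  have hun : range h = h '' A ∪ h '' B := by
    rw [← image_union, ← image_univ]
    congr 1
    exact (eq_univ_of_forall hAB).symm
  rw [hun, closure_union] at hy
  rcases hy with hy | hy
  · have hne : A.Nonempty := by
      by_contra hA
      rw [not_nonempty_iff_eq_empty.1 hA] at hy
      simp at hy
    obtain ⟨a, ha, hacl⟩ := (h3 A hne).2
    have haA : a ∈ A := closure_minimal hAl hAc hacl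
    refine hdis a haA ?_
    have : h '' A ⊆ {z | z * h a = z} := by
      rintro _ ⟨x, hx, rfl⟩
      change h x * h a = h x
      rw [← hm, inf_eq_left.2 (ha.1 hx)]
    exact closure_minimal this (isClosed_eq (rm _) continuous_id) hy
  · have hne : B.Nonempty := by
      by_contra hB
      rw [not_nonempty_iff_eq_empty.1 hB] at hy
      simp at hy
    obtain ⟨b, hb, hbcl⟩ := (h3 B hne).1
    have hbB : b ∈ B := closure_minimal hBu hBc hbcl
    refine hdis b ?_ hbB
    have : h '' B ⊆ {z | z * h b = h b} := by
      rintro _ ⟨x, hx, rfl⟩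
      change h x * h b = h b
      rw [← hm, inf_eq_right.2 (hb.1 hx)]
    exact closure_minimal this (isClosed_eq (rm _) continuous_const) hy

end helpers

/-- Gutik–Repovš: for a linear Hausdorff topological semilattice `X`, the following are
equivalent: (1) every continuous homomorphism into a Hausdorff topological semigroup has
closed image; (2) every isomorphic topological embedding into a Hausdorff topological
semigroup has closed image; (3) every nonempty subset `C ⊆ X` has `inf C ∈ closure (↑C)`
and `sup C ∈ closure (↓C)`. -/
theorem stmt16 {X : Type u} [SemilatticeInf X] [TopologicalSpace X] [T2Space X]
    (hXcont : Continuous fun p : X × X => p.1 ⊓ p.2)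
    (hlin : ∀ x y : X, x ⊓ y = x ∨ x ⊓ y = y) :
    ((∀ (Y : Type u) [Semigroup Y] [TopologicalSpace Y] [T2Space Y],
        (Continuous fun p : Y × Y => p.1 * p.2) →
        ∀ h : X → Y, Continuous h → (∀ a b : X, h (a ⊓ b) = h a * h b) →
          IsClosed (Set.range h)) ↔
      (∀ C : Set X, C.Nonempty →
        (∃ a, IsGLB C a ∧ a ∈ closure (⋃ c ∈ C, Set.Ici c)) ∧
        (∃ b, IsLUB C b ∧ b ∈ closure (⋃ c ∈ C, Set.Iic c)))) ∧
    ((∀ (Y : Type u) [Semigroup Y] [TopologicalSpace Y] [T2Space Y],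
        (Continuous fun p : Y × Y => p.1 * p.2) →
        ∀ f : X → Y, (∀ a b : X, f (a ⊓ b) = f a * f b) → IsEmbedding f →
          IsClosed (Set.range f)) ↔
      (∀ C : Set X, C.Nonempty →
        (∃ a, IsGLB C a ∧ a ∈ closure (⋃ c ∈ C, Set.Ici c)) ∧
        (∃ b, IsLUB C b ∧ b ∈ closure (⋃ c ∈ C, Set.Iic c)))) := by
  refine ⟨⟨fun h1 => two_three hXcont hlin ?_, fun h3 Y _ _ _ hY h hc hm =>
      three_one hlin h3 Y hY h hc hm⟩,
    ⟨fun h2 => two_three hXcont hlin h2, fun h3 Y _ _ _ hY f hm hf =>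
      three_one hlin h3 Y hY f hf.continuous hm⟩⟩
  intro Y _ _ _ hY f hm hf
  exact h1 Y hY f hf.continuous hm
end

section
/- Let X be a linear Hausdorff topological semilattice, i.e., a Hausdorff topological semilattice in which x ⊓ y ∈ {x, y} for all x, y ∈ X. Then X is finite if and only if for every isomorphic topological embedding f of X into a topological semilattice Y satisfying the separation axiom T₁ (all singletons of Y are closed), the image f(X) is closed in Y. -/
open Set Topology

universe u

open Filter

/-- every embedding into a `T₁` topological semilattice is closed -/
def HClosed (X : Type u) [SemilatticeInf X] [TopologicalSpace X] : Prop :=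
  ∀ (Y : Type u) [SemilatticeInf Y] [TopologicalSpace Y] [T1Space Y],
        (Continuous fun p : Y × Y => p.1 ⊓ p.2) →
        ∀ f : X → Y, (∀ a b : X, f (a ⊓ b) = f a ⊓ f b) → IsEmbedding f →
          IsClosed (Set.range f)

/-- Building a bad embedding from a neighbourhood assignment. -/
lemma build {X Y : Type u} [TopologicalSpace X] [SemilatticeInf X] [SemilatticeInf Y]
    (H : HClosed X) (n : Y → Filter Y) (h0 : pure ≤ n)
    (h1 : ∀ a, ∀ s ∈ n a, ∀ᶠ y in n a, s ∈ n y)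
    (hinf : ∀ a b, Tendsto (fun p : Y × Y => p.1 ⊓ p.2) (n a ×ˢ n b) (n (a ⊓ b)))
    (hT : ∀ a b, b ≠ a → {b}ᶜ ∈ n a)
    (f : X → Y) (hf : ∀ a b : X, f (a ⊓ b) = f a ⊓ f b) (inj : Function.Injective f)
    (hind : ∀ x, 𝓝 x = comap f (n (f x)))
    (q : Y) (hq : q ∉ range f) (hcl : ∀ s ∈ n q, ∃ x, f x ∈ s) : False := by
  letI : TopologicalSpace Y := TopologicalSpace.mkOfNhds n
  have hn : ∀ a, 𝓝 a = n a := fun a => TopologicalSpace.nhds_mkOfNhds n a h0 h1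
  haveI : T1Space Y := by
    refine ⟨fun b => ?_⟩
    rw [← isOpen_compl_iff, isOpen_iff_mem_nhds]
    intro a ha
    rw [hn]
    exact hT a b (fun h => ha h.symm)
  have hc : Continuous fun p : Y × Y => p.1 ⊓ p.2 := by
    rw [continuous_iff_continuousAt]
    rintro ⟨a, b⟩
    rw [ContinuousAt, nhds_prod_eq, hn, hn, hn]
    exact hinf a b
  have he : IsEmbedding f := ⟨isInducing_iff_nhds.2 (fun x => by rw [hn]; exact hind x), inj⟩
  have hcl' := H Y hc f hf he
  apply hq
  rw [← hcl'.closure_eq, mem_closure_iff_nhds]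
  intro t ht
  rw [hn] at ht
  obtain ⟨x, hx⟩ := hcl t ht
  exact ⟨f x, hx, x, rfl⟩

section One

variable {X : Type u} [LinearOrder X]

/-- `X` with one new point -/
inductive Opt_s17 (X : Type u) : Type u
  | nw : Opt_s17 X
  | old : X → Opt_s17 X

lemma Opt_s17.old_inj : Function.Injective (Opt_s17.old : X → Opt_s17 X) := fun _ _ h => Opt_s17.old.inj h

open Classical in
/-- meet on `Opt X` with the new point right above `L` -/
noncomputable def infO (L : Set X) : Opt_s17 X → Opt_s17 X → Opt_s17 X
  | Opt_s17.old x, Opt_s17.old y => Opt_s17.old (x ⊓ y)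
  | Opt_s17.old x, Opt_s17.nw => if x ∈ L then Opt_s17.old x else Opt_s17.nw
  | Opt_s17.nw, Opt_s17.old x => if x ∈ L then Opt_s17.old x else Opt_s17.nw
  | Opt_s17.nw, Opt_s17.nw => Opt_s17.nw

/-- semilattice structure on `Opt X` -/
noncomputable abbrev semO (L : Set X) (hL : IsLowerSet L) : SemilatticeInf (Opt_s17 X) :=
  letI : Min (Opt_s17 X) := ⟨infO L⟩
  SemilatticeInf.mk'
    (by
      rintro (_ | a) (_ | b)
      · rfl
      · rfl
      · rfl
      · exact congrArg Opt_s17.old (inf_comm a b))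
    (by
      have key : ∀ a b : X, a ⊓ b ∈ L ↔ a ∈ L ∨ b ∈ L := by
        intro a b
        constructor
        · intro h
          rcases le_total a b with h' | h'
          · left; rwa [inf_eq_left.2 h'] at h
          · right; rwa [inf_eq_right.2 h'] at h
        · rintro (h | h)
          · exact hL inf_le_left h
          · exact hL inf_le_right h
      have k2 : ∀ a b : X, a ∈ L → b ∉ L → a ⊓ b = a := fun a b ha hb =>
        inf_eq_left.2 (le_of_not_ge fun h => hb (hL h ha))
      have k3 : ∀ a b : X, a ∈ L → b ∉ L → b ⊓ a = a := fun a b ha hb => by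
        rw [inf_comm]; exact k2 a b ha hb
      intro a b c
      change infO L (infO L a b) c = infO L a (infO L b c)
      rcases a with _ | a <;> rcases b with _ | b <;> rcases c with _ | c
      · rfl
      · by_cases hc : c ∈ L <;> simp [infO, hc]
      · by_cases hc : b ∈ L <;> simp [infO, hc]
      · by_cases hb : b ∈ L <;> by_cases hc : c ∈ L <;>
          simp [infO, hb, hc, -inf_eq_left, -inf_eq_right, key, k2, k3]
      · by_cases hc : a ∈ L <;> simp [infO, hc]
      · by_cases hb : a ∈ L <;> by_cases hc : c ∈ L <;>
          simp [infO, hb, hc, -inf_eq_left, -inf_eq_right, key, k2, k3]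
      · by_cases hb : a ∈ L <;> by_cases hc : b ∈ L <;>
          simp [infO, hb, hc, -inf_eq_left, -inf_eq_right, key, k2, k3]
      · simp [infO, inf_assoc])
    (by
      rintro (_ | a)
      · rfl
      · exact congrArg Opt_s17.old (inf_idem a))

lemma caseOne [TopologicalSpace X] [OrderClosedTopology X]
    (hXcont : Continuous fun p : X × X => p.1 ⊓ p.2)
    (H : HClosed X) (L : Set X) (hL : IsLowerSet L)
    (hne : L.Nonempty) (hmax : ∀ x ∈ L, ∃ y ∈ L, x < y) : False := by
  classical
  letI := semO L hL
  have hinfdef : ∀ a b : Opt_s17 X, a ⊓ b = infO L a b := fun _ _ => rfl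
  have hLo : IsOpen L := by
    rw [isOpen_iff_mem_nhds]
    intro x hx
    obtain ⟨y, hy, hxy⟩ := hmax x hx
    filter_upwards [Iio_mem_nhds hxy] with z hz using hL (le_of_lt hz) hy
  obtain ⟨a0, ha0⟩ := hne
  haveI : Nonempty L := ⟨⟨a0, ha0⟩⟩
  let F : Filter X := map ((↑) : L → X) atTop
  have hF : ∀ s : Set X, s ∈ F ↔ ∃ a ∈ L, ∀ x ∈ L, a < x → x ∈ s := by
    intro s
    rw [mem_map, mem_atTop_sets]
    constructor
    · rintro ⟨a, ha⟩
      exact ⟨a, a.2, fun x hx hax => ha ⟨x, hx⟩ (le_of_lt hax)⟩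
    · rintro ⟨a, ha, h⟩
      obtain ⟨b, hb, hab⟩ := hmax a ha
      exact ⟨⟨b, hb⟩, fun c hc => h c c.2 (lt_of_lt_of_le hab hc)⟩
  have hFne : F.NeBot := inferInstance
  have hFL : ∀ a ∈ L, ∀ᶠ x in F, x ∈ L ∧ a < x := fun a ha =>
    (hF _).2 ⟨a, ha, fun x hx h => ⟨hx, h⟩⟩
  clear_value F
  let n : Opt_s17 X → Filter (Opt_s17 X) := fun a =>
    Opt_s17.casesOn a (pure Opt_s17.nw ⊔ map Opt_s17.old F) (fun x => map Opt_s17.old (𝓝 x))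
  have nn : n Opt_s17.nw = pure Opt_s17.nw ⊔ map Opt_s17.old F := rfl
  have ns : ∀ x, n (Opt_s17.old x) = map Opt_s17.old (𝓝 x) := fun _ => rfl
  clear_value n
  have hXt : ∀ x y : X, Tendsto (fun p : X × X => p.1 ⊓ p.2) (𝓝 x ×ˢ 𝓝 y) (𝓝 (x ⊓ y)) := by
    intro x y
    rw [← nhds_prod_eq]
    exact hXcont.tendsto (x, y)
  -- meet of the new point with old points
  have hmix : ∀ x, Tendsto (fun p : Opt_s17 X × Opt_s17 X => p.1 ⊓ p.2)
      (n (Opt_s17.old x) ×ˢ n Opt_s17.nw) (n (Opt_s17.old x ⊓ Opt_s17.nw)) := by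
    intro x
    rw [hinfdef]
    by_cases hx : x ∈ L
    · have e : infO L (Opt_s17.old x) Opt_s17.nw = Opt_s17.old x := by simp [infO, hx]
      rw [e, ns, nn, prod_sup, tendsto_sup]
      obtain ⟨b, hb, hxb⟩ := hmax x hx
      constructor
      · rw [prod_pure, map_map, tendsto_map'_iff]
        refine Tendsto.congr' ?_ tendsto_map
        filter_upwards [hLo.mem_nhds hx] with y hy
        simp [hinfdef, infO, hy]
      · rw [prod_map_map_eq, tendsto_map'_iff]
        refine Tendsto.congr' ?_ (tendsto_map.comp tendsto_fst)
        filter_upwards [prod_mem_prod (Iio_mem_nhds hxb) (hFL b hb)] with p hp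
        have : p.1 ≤ p.2 := le_of_lt (lt_trans hp.1 hp.2.2)
        simp [hinfdef, infO, this]
    · have e : infO L (Opt_s17.old x) Opt_s17.nw = Opt_s17.nw := by simp [infO, hx]
      have hgt : ∀ a ∈ L, a < x := fun a ha => lt_of_not_ge fun h => hx (hL h ha)
      rw [e, ns, nn, prod_sup, tendsto_sup]
      constructor
      · rw [prod_pure, map_map, tendsto_map'_iff]
        intro s hs
        obtain ⟨h1, h2⟩ := mem_sup.1 hs
        obtain ⟨a, ha, h⟩ := (hF _).1 h2
        rw [mem_map]
        filter_upwards [Ioi_mem_nhds (hgt a ha)] with y hy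
        by_cases hyL : y ∈ L
        · have := h y hyL hy
          simpa [hinfdef, infO, hyL] using this
        · simpa [hinfdef, infO, hyL] using h1
      · rw [prod_map_map_eq, tendsto_map'_iff]
        intro s hs
        obtain ⟨h1, h2⟩ := mem_sup.1 hs
        obtain ⟨a, ha, h⟩ := (hF _).1 h2
        rw [mem_map]
        filter_upwards [prod_mem_prod (Ioi_mem_nhds (hgt a ha)) (hFL a ha)] with p hp
        exact h (p.1 ⊓ p.2) (hL inf_le_right hp.2.1) (lt_inf_iff.2 ⟨hp.1, hp.2.2⟩)
  refine build H n ?_ ?_ ?_ ?_ Opt_s17.old (fun _ _ => rfl) (Opt_s17.old_inj) ?_ Opt_s17.nw (by simp) ?_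
  · rintro (_ | x)
    · rw [nn]; exact le_sup_left
    · rw [ns, ← map_pure]; exact map_mono (pure_le_nhds x)
  · rintro (_ | x) s hs
    · rw [nn]
      refine eventually_sup.2 ⟨by simpa using hs, ?_⟩
      rw [nn] at hs
      obtain ⟨a, ha, h⟩ := (hF _).1 (mem_sup.1 hs).2
      rw [eventually_map]
      filter_upwards [hFL a ha] with x hx
      rw [ns, mem_map]
      filter_upwards [hLo.mem_nhds hx.1, Ioi_mem_nhds hx.2] with y h1 h2 using h y h1 h2
    · rw [ns] at hs ⊢
      rw [eventually_map]
      filter_upwards [eventually_mem_nhds_iff.2 (mem_map.1 hs)] with y hy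
      rw [ns]; exact hy
  · rintro (_ | x) (_ | y)
    · change Tendsto _ _ (n Opt_s17.nw)
      rw [nn, sup_prod, prod_sup, prod_sup, tendsto_sup, tendsto_sup, tendsto_sup]
      have hh : ∀ᶠ y in F, y ∈ L := (hFL a0 ha0).mono fun _ h => h.1
      refine ⟨⟨?_, ?_⟩, ?_, ?_⟩
      · rw [prod_pure_pure]
        refine Tendsto.mono_right (tendsto_pure_pure _ _) le_sup_left
      · rw [pure_prod, map_map, tendsto_map'_iff]
        refine Tendsto.mono_right ?_ le_sup_right
        refine Tendsto.congr' ?_ tendsto_map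
        filter_upwards [hh] with y hy
        simp [hinfdef, infO, hy]
      · rw [prod_pure, map_map, tendsto_map'_iff]
        refine Tendsto.mono_right ?_ le_sup_right
        refine Tendsto.congr' ?_ tendsto_map
        filter_upwards [hh] with y hy
        simp [hinfdef, infO, hy]
      · rw [prod_map_map_eq, tendsto_map'_iff]
        refine Tendsto.mono_right ?_ le_sup_right
        intro s hs
        have hs' := mem_map.1 hs
        rw [mem_map]
        filter_upwards [prod_mem_prod hs' hs'] with p hp
        rcases le_total p.1 p.2 with h | h
        · have := hp.1
          simpa [hinfdef, infO, h] using this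
        · have := hp.2
          simpa [hinfdef, infO, h] using this
    · have := (hmix y).comp (tendsto_prod_swap : Tendsto _ (n Opt_s17.nw ×ˢ n (Opt_s17.old y)) _)
      rw [inf_comm]
      refine this.congr fun p => ?_
      exact inf_comm _ _
    · exact hmix x
    · change Tendsto _ _ (n (Opt_s17.old (x ⊓ y)))
      rw [ns, ns, ns, prod_map_map_eq, tendsto_map'_iff]
      exact tendsto_map.comp (hXt x y)
  · rintro (_ | x) (_ | y) hne
    · exact absurd rfl hne
    · rw [nn]
      refine mem_sup.2 ⟨by simp, ?_⟩
      rw [mem_map]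
      by_cases hy : y ∈ L
      · filter_upwards [hFL y hy] with z hz
        simpa using hz.2.ne'
      · filter_upwards [hFL a0 ha0] with z hz
        have : z ≠ y := fun h => hy (h ▸ hz.1)
        simpa using this
    · rw [ns, mem_map]; exact Eventually.of_forall fun z h => by cases h
    · rw [ns, mem_map]
      have : x ≠ y := fun h => hne (by rw [h])
      filter_upwards [isOpen_ne.mem_nhds this] with z hz
      simpa using hz
  · intro x
    rw [ns, comap_map (Opt_s17.old_inj)]
  · intro s hs
    rw [nn] at hs
    exact hFne.nonempty_of_mem (mem_map.1 (mem_sup.1 hs).2)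

end One

section Two

variable {X : Type u} [LinearOrder X]

/-- the doubled semilattice -/
def Dbl (U : Set X) : Type u := {y : X × Prop // y.2 → y.1 ∈ U}

noncomputable instance (U : Set X) [hU : Fact (IsUpperSet U)] : SemilatticeInf (Dbl U) :=
  Subtype.semilatticeInf (by
    intro x y hx hy h
    rcases le_total x.1 y.1 with h' | h'
    · have : (x ⊓ y).1 = x.1 := inf_eq_left.2 h'
      rw [this]; exact hx h.1
    · have : (x ⊓ y).1 = y.1 := inf_eq_right.2 h'
      rw [this]; exact hy h.2)

lemma caseTwo [TopologicalSpace X] [OrderClosedTopology X]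
    (hXcont : Continuous fun p : X × X => p.1 ⊓ p.2)
    (H : HClosed X) (U : Set X) (hU : IsUpperSet U)
    (hne : U.Nonempty) (hmin : ∀ x ∈ U, ∃ y ∈ U, y < x)
    (F : Filter X) (hFne : F.NeBot) (hFU : U ∈ F) (hFI : ∀ w ∈ U, Iio w ∈ F)
    (hFo : ∀ s ∈ F, ∀ᶠ x in F, s ∈ 𝓝 x)
    (hFx : ∀ x, x ∉ U → F ≤ 𝓝 x ∨ Uᶜ ∈ 𝓝 x) : False := by
  classical
  haveI : Fact (IsUpperSet U) := ⟨hU⟩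
  have hUo : IsOpen U := by
    rw [isOpen_iff_mem_nhds]
    intro x hx
    obtain ⟨y, hy, hxy⟩ := hmin x hx
    filter_upwards [Ioi_mem_nhds hxy] with z hz using hU (le_of_lt hz) hy
  let i : X → Dbl U := fun x => ⟨(x, x ∈ U), fun h => h⟩
  let j : X → Dbl U := fun x => ⟨(x, False), fun h => h.elim⟩
  have hij : ∀ x, x ∉ U → i x = j x := by
    intro x hx
    apply Subtype.ext
    simp [i, j, hx]
  have hcases : ∀ y : Dbl U, (∃ x, y = j x) ∨ ∃ x ∈ U, y = i x := by
    rintro ⟨⟨x, p⟩, h⟩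
    by_cases hp : p
    · right
      refine ⟨x, h hp, Subtype.ext ?_⟩
      simp [i, hp, show x ∈ U from h hp]
    · left
      refine ⟨x, Subtype.ext ?_⟩
      simp [j, hp]
  have hii : ∀ x y, i x ⊓ i y = i (x ⊓ y) := by
    intro x y
    apply Subtype.ext
    refine Prod.ext rfl ?_
    change (x ∈ U ∧ y ∈ U) = (x ⊓ y ∈ U)
    rw [eq_iff_iff]
    constructor
    · rintro ⟨h1, h2⟩
      rcases le_total x y with h | h
      · rwa [inf_eq_left.2 h]
      · rwa [inf_eq_right.2 h]
    · exact fun h => ⟨hU inf_le_left h, hU inf_le_right h⟩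
  have hjj : ∀ x y, j x ⊓ j y = j (x ⊓ y) := by
    intro x y
    apply Subtype.ext
    refine Prod.ext rfl ?_
    change (False ∧ False) = False
    simp
  have hi_j : ∀ x y, i x ⊓ j y = j (x ⊓ y) := by
    intro x y
    apply Subtype.ext
    refine Prod.ext rfl ?_
    change (x ∈ U ∧ False) = False
    simp
  have hj_i : ∀ x y, j x ⊓ i y = j (x ⊓ y) := by
    intro x y
    rw [inf_comm, hi_j, inf_comm]
  have iinj : ∀ x y, i x = i y → x = y := fun x y h => congrArg (fun z => z.1.1) h
  have jinj : ∀ x y, j x = j y → x = y := fun x y h => congrArg (fun z => z.1.1) h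
  have ijne : ∀ x y, i x = j y → x = y := fun x y h => congrArg (fun z => z.1.1) h
  have ijU : ∀ x y, i x = j y → x ∉ U := fun x y h hx => by
    have : (x ∈ U) = False := congrArg (fun z => z.1.2) h
    rw [this] at hx; exact hx
  have hπi : ∀ x, (i x).1.1 = x := fun _ => rfl
  have hπj : ∀ x, (j x).1.1 = x := fun _ => rfl
  have hbi : ∀ x ∈ U, (i x).1.2 := fun x hx => hx
  have hbj : ∀ x, ¬ (j x).1.2 := fun x hx => hx
  clear_value i j
  let G : X → Filter X := fun x => if x ∈ U then F else 𝓝 x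
  have GU : ∀ x ∈ U, G x = F := fun x hx => by simp [G, hx]
  have GN : ∀ x, x ∉ U → G x = 𝓝 x := fun x hx => by simp [G, hx]
  clear_value G
  let n : Dbl U → Filter (Dbl U) := fun y =>
    if y.1.2 then map i (𝓝 y.1.1) else map j (𝓝 y.1.1) ⊔ (map j (G y.1.1) ⊔ map i (G y.1.1))
  have ni : ∀ x ∈ U, n (i x) = map i (𝓝 x) := by
    intro x hx
    simp only [n, if_pos (hbi x hx), hπi]
  have nj : ∀ x, n (j x) = map j (𝓝 x) ⊔ (map j (G x) ⊔ map i (G x)) := by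
    intro x
    simp only [n, if_neg (hbj x), hπj]
  clear_value n
  have mem_nj : ∀ x s, s ∈ n (j x) ↔ j ⁻¹' s ∈ 𝓝 x ∧ j ⁻¹' s ∈ G x ∧ i ⁻¹' s ∈ G x := by
    intro x s
    rw [nj]; rfl
  have mem_ni : ∀ x ∈ U, ∀ s, s ∈ n (i x) ↔ i ⁻¹' s ∈ 𝓝 x := by
    intro x hx s
    rw [ni x hx]; rfl
  have hXt : ∀ x y : X, Tendsto (fun p : X × X => p.1 ⊓ p.2) (𝓝 x ×ˢ 𝓝 y) (𝓝 (x ⊓ y)) := by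
    intro x y
    rw [← nhds_prod_eq]
    exact hXcont.tendsto (x, y)
  have infU : ∀ x ∈ U, ∀ y ∈ U, x ⊓ y ∈ U := by
    intro x hx y hy
    rcases le_total x y with h | h
    · rwa [inf_eq_left.2 h]
    · rwa [inf_eq_right.2 h]
  have infN : ∀ x y, y ∉ U → x ⊓ y ∉ U := fun x y hy h => hy (hU inf_le_right h)
  have infE : ∀ x ∈ U, ∀ y, y ∉ U → x ⊓ y = y := fun x hx y hy =>
    inf_eq_right.2 (le_of_not_ge fun h => hy (hU h hx))
  have tFN : ∀ y, y ∉ U → Tendsto (fun p : X × X => p.1 ⊓ p.2) (F ×ˢ 𝓝 y) (𝓝 y) := by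
    intro y hy
    rcases hFx y hy with h | h
    · have := hXt y y
      rw [inf_idem] at this
      exact this.mono_left (prod_mono h le_rfl)
    · refine Tendsto.congr' ?_ tendsto_snd
      filter_upwards [prod_mem_prod hFU h] with p hp
      exact (infE _ hp.1 _ hp.2).symm
  have tG𝓝 : ∀ x y, Tendsto (fun p : X × X => p.1 ⊓ p.2) (G x ×ˢ 𝓝 y) (G (x ⊓ y)) := by
    intro x y
    by_cases hx : x ∈ U
    · by_cases hy : y ∈ U
      · rw [GU x hx, GU _ (infU x hx y hy)]
        refine Tendsto.congr' ?_ tendsto_fst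
        obtain ⟨w, hw, hwy⟩ := hmin y hy
        filter_upwards [prod_mem_prod (hFI w hw) (Ioi_mem_nhds hwy)] with p hp
        exact (inf_eq_left.2 (le_of_lt (lt_trans hp.1 hp.2))).symm
      · rw [GU x hx, GN _ (infN x y hy), infE x hx y hy]
        exact tFN y hy
    · have : x ⊓ y ∉ U := by rw [inf_comm]; exact infN y x hx
      rw [GN x hx, GN _ this]
      exact hXt x y
  have t𝓝G : ∀ x y, Tendsto (fun p : X × X => p.1 ⊓ p.2) (𝓝 x ×ˢ G y) (G (x ⊓ y)) := by
    intro x y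
    have := (tG𝓝 y x).comp (tendsto_prod_swap : Tendsto _ (𝓝 x ×ˢ G y) _)
    rw [inf_comm]
    exact this.congr fun p => inf_comm _ _
  have tGG : ∀ x y, Tendsto (fun p : X × X => p.1 ⊓ p.2) (G x ×ˢ G y) (G (x ⊓ y)) := by
    intro x y
    by_cases hy : y ∈ U
    · by_cases hx : x ∈ U
      · rw [GU x hx, GU y hy, GU _ (infU x hx y hy)]
        intro s hs
        rw [mem_map]
        filter_upwards [prod_mem_prod hs hs] with p hp
        change p.1 ⊓ p.2 ∈ s
        rcases le_total p.1 p.2 with h | h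
        · rw [inf_eq_left.2 h]; exact hp.1
        · rw [inf_eq_right.2 h]; exact hp.2
      · rw [GN x hx]; exact t𝓝G x y
    · rw [GN y hy]; exact tG𝓝 x y
  have glue : ∀ (f g h : X → Dbl U) (A B C : Filter X), (∀ x y, f x ⊓ g y = h (x ⊓ y)) →
      Tendsto (fun p : X × X => p.1 ⊓ p.2) (A ×ˢ B) C →
      Tendsto (fun p : Dbl U × Dbl U => p.1 ⊓ p.2) (map f A ×ˢ map g B) (map h C) := by
    intro f g h A B C hfg ht
    rw [prod_map_map_eq, tendsto_map'_iff]
    exact (tendsto_map.comp ht).congr fun p => (hfg _ _).symm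
  have hmix : ∀ x ∈ U, ∀ y, Tendsto (fun p : Dbl U × Dbl U => p.1 ⊓ p.2)
      (n (i x) ×ˢ n (j y)) (n (i x ⊓ j y)) := by
    intro x hx y
    rw [hi_j, ni x hx, nj, nj, prod_sup, prod_sup]
    exact (glue _ _ _ _ _ _ hi_j (hXt x y)).sup_sup
      ((glue _ _ _ _ _ _ hi_j (t𝓝G x y)).sup_sup (glue _ _ _ _ _ _ hii (t𝓝G x y)))
  obtain ⟨u, hu⟩ := hne
  have Gne : ∀ x ∈ U, ∀ z, ∀ᶠ y in G x, y ≠ z := by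
    intro x hx z
    rw [GU x hx]
    by_cases hz : z ∈ U
    · filter_upwards [hFI z hz] with y hy using ne_of_lt hy
    · filter_upwards [hFU] with y hy using fun h => hz (h ▸ hy)
  have Nne : ∀ x z : X, x ≠ z → ∀ᶠ y in 𝓝 x, y ≠ z := fun x z h => isOpen_ne.mem_nhds h
  refine build H n ?_ ?_ ?_ ?_ i (fun a b => (hii a b).symm) (fun a b => iinj a b) ?_ (j u) ?_ ?_
  · intro y
    rcases hcases y with ⟨x, rfl⟩ | ⟨x, hx, rfl⟩
    · rw [nj, ← map_pure]; exact le_sup_of_le_left (map_mono (pure_le_nhds x))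
    · rw [ni x hx, ← map_pure]; exact map_mono (pure_le_nhds x)
  · intro y s hs
    rcases hcases y with ⟨x, rfl⟩ | ⟨x, hx, rfl⟩
    · have hs' := hs
      rw [mem_nj] at hs
      obtain ⟨h1, h2, h3⟩ := hs
      by_cases hx : x ∈ U
      · rw [GU x hx] at h2 h3
        refine (mem_nj _ _).2 ⟨?_, ?_, ?_⟩
        · filter_upwards [hUo.mem_nhds hx, eventually_mem_nhds_iff.2 h1] with z hz hz1
          change s ∈ n (j z)
          rw [mem_nj, GU z hz]
          exact ⟨hz1, h2, h3⟩
        · rw [GU x hx]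
          filter_upwards [hFU, hFo _ h2] with z hz hz1
          change s ∈ n (j z)
          rw [mem_nj, GU z hz]
          exact ⟨hz1, h2, h3⟩
        · rw [GU x hx]
          filter_upwards [hFU, hFo _ h3] with z hz hz1
          change s ∈ n (i z)
          rw [mem_ni z hz]
          exact hz1
      · rw [GN x hx] at h2 h3
        have key : ∀ᶠ z in 𝓝 x, s ∈ n (j z) ∧ s ∈ n (i z) := by
          rcases hFx x hx with hF | hF
          · filter_upwards [eventually_mem_nhds_iff.2 h1, eventually_mem_nhds_iff.2 h3]
              with z hz1 hz3
            have : s ∈ n (j z) := by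
              rw [mem_nj]
              by_cases hz : z ∈ U
              · rw [GU z hz]; exact ⟨hz1, hF h2, hF h3⟩
              · rw [GN z hz]; exact ⟨hz1, hz1, hz3⟩
            refine ⟨this, ?_⟩
            by_cases hz : z ∈ U
            · rw [mem_ni z hz]; exact hz3
            · rw [hij z hz]; exact this
          · filter_upwards [eventually_mem_nhds_iff.2 h1, eventually_mem_nhds_iff.2 h3, hF]
              with z hz1 hz3 hz
            have : s ∈ n (j z) := by
              rw [mem_nj, GN z hz]; exact ⟨hz1, hz1, hz3⟩
            exact ⟨this, by rw [hij z hz]; exact this⟩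
        refine (mem_nj _ _).2 ⟨?_, ?_, ?_⟩
        · exact key.mono fun z hz => hz.1
        · rw [GN x hx]; exact key.mono fun z hz => hz.1
        · rw [GN x hx]; exact key.mono fun z hz => hz.2
    · refine (mem_ni x hx _).2 ?_
      rw [mem_ni x hx] at hs
      filter_upwards [hUo.mem_nhds hx, eventually_mem_nhds_iff.2 hs] with z hz hz1
      change s ∈ n (i z)
      rw [mem_ni z hz]; exact hz1
  · intro a b
    rcases hcases a with ⟨x, rfl⟩ | ⟨x, hx, rfl⟩ <;> rcases hcases b with ⟨y, rfl⟩ | ⟨y, hy, rfl⟩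
    · rw [hjj, nj, nj, nj]
      simp only [sup_prod, prod_sup]
      have jm : map j (G (x ⊓ y)) ≤ map j (𝓝 (x ⊓ y)) ⊔ (map j (G (x ⊓ y)) ⊔ map i (G (x ⊓ y))) :=
        le_sup_of_le_right le_sup_left
      have im : map i (G (x ⊓ y)) ≤ map j (𝓝 (x ⊓ y)) ⊔ (map j (G (x ⊓ y)) ⊔ map i (G (x ⊓ y))) :=
        le_sup_of_le_right le_sup_right
      simp only [tendsto_sup]
      have a1 := (glue _ _ _ _ _ _ hjj (hXt x y)).mono_right
        (le_sup_left : _ ≤ _ ⊔ (map j (G (x ⊓ y)) ⊔ map i (G (x ⊓ y))))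
      have a2 := (glue _ _ _ _ _ _ hjj (tG𝓝 x y)).mono_right jm
      have a3 := (glue _ _ _ _ _ _ hi_j (tG𝓝 x y)).mono_right jm
      have b1 := (glue _ _ _ _ _ _ hjj (t𝓝G x y)).mono_right jm
      have b2 := (glue _ _ _ _ _ _ hjj (tGG x y)).mono_right jm
      have b3 := (glue _ _ _ _ _ _ hi_j (tGG x y)).mono_right jm
      have c1 := (glue _ _ _ _ _ _ hj_i (t𝓝G x y)).mono_right jm
      have c2 := (glue _ _ _ _ _ _ hj_i (tGG x y)).mono_right jm
      have c3 := (glue _ _ _ _ _ _ hii (tGG x y)).mono_right im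
      tauto
    · have := (hmix y hy x).comp (tendsto_prod_swap : Tendsto _ (n (j x) ×ˢ n (i y)) _)
      rw [inf_comm]
      exact this.congr fun p => inf_comm _ _
    · exact hmix x hx y
    · rw [hii, ni x hx, ni y hy, ni _ (infU x hx y hy)]
      exact glue _ _ _ _ _ _ hii (hXt x y)
  · intro a b hab
    rcases hcases a with ⟨x, rfl⟩ | ⟨x, hx, rfl⟩
    · rw [mem_nj]
      rcases hcases b with ⟨z, rfl⟩ | ⟨z, hz, rfl⟩
      · have hxz : x ≠ z := fun h => hab (by rw [h])
        have hG : ∀ᶠ y in G x, y ≠ z := by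
          by_cases hx : x ∈ U
          · exact Gne x hx z
          · rw [GN x hx]; exact Nne x z hxz
        exact ⟨(Nne x z hxz).mono fun y hy h => hy (jinj _ _ h),
          hG.mono fun y hy h => hy (jinj _ _ h), hG.mono fun y hy h => hy (ijne _ _ h)⟩
      · have hG : ∀ᶠ y in G x, y ≠ z := by
          by_cases hx : x ∈ U
          · exact Gne x hx z
          · rw [GN x hx]; exact Nne x z (fun h => hx (h ▸ hz))
        exact ⟨Eventually.of_forall fun y h => ijU _ _ (Eq.symm h) hz,
          Eventually.of_forall fun y h => ijU _ _ (Eq.symm h) hz,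
          hG.mono fun y hy h => hy (iinj _ _ h)⟩
    · rw [mem_ni x hx]
      rcases hcases b with ⟨z, rfl⟩ | ⟨z, hz, rfl⟩
      · filter_upwards [hUo.mem_nhds hx] with y hy h using ijU _ _ h hy
      · have hxz : x ≠ z := fun h => hab (by rw [h])
        exact (Nne x z hxz).mono fun y hy h => hy (iinj _ _ h)
  · intro x
    by_cases hx : x ∈ U
    · rw [ni x hx, comap_map (fun a b => iinj a b)]
    · rw [hij x hx]
      ext s
      rw [mem_comap]
      constructor
      · intro hs
        refine ⟨(fun y : Dbl U => y.1.1) ⁻¹' s, ?_, ?_⟩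
        · rw [mem_nj, GN x hx]
          refine ⟨?_, ?_, ?_⟩ <;> filter_upwards [hs] with y hy
          · simpa [hπj] using hy
          · simpa [hπj] using hy
          · simpa [hπi] using hy
        · intro y hy
          simpa [hπi] using hy
      · rintro ⟨t, ht, hts⟩
        rw [mem_nj, GN x hx] at ht
        exact mem_of_superset ht.2.2 hts
  · rintro ⟨x, hx⟩
    have := ijne _ _ hx
    exact ijU _ _ hx (this ▸ hu)
  · intro s hs
    rw [mem_nj, GU u hu] at hs
    exact hFne.nonempty_of_mem hs.2.2

lemma caseThree [TopologicalSpace X] [OrderClosedTopology X]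
    (hXcont : Continuous fun p : X × X => p.1 ⊓ p.2)
    (H : HClosed X) (U : Set X) (hU : IsUpperSet U)
    (hne : U.Nonempty) (hmin : ∀ x ∈ U, ∃ y ∈ U, y < x) : False := by
  have hUo : IsOpen U := by
    rw [isOpen_iff_mem_nhds]
    intro x hx
    obtain ⟨y, hy, hxy⟩ := hmin x hx
    filter_upwards [Ioi_mem_nhds hxy] with z hz using hU (le_of_lt hz) hy
  have hlt : ∀ x, x ∉ U → ∀ w ∈ U, x < w := fun x hx w hw =>
    lt_of_not_ge fun h => hx (hU h hw)
  by_cases hp : ∃ p, p ∉ U ∧ p ∈ closure U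
  · obtain ⟨p, hpU, hpc⟩ := hp
    refine caseTwo hXcont H U hU hne hmin (𝓝[U] p) (mem_closure_iff_nhdsWithin_neBot.1 hpc)
      self_mem_nhdsWithin (fun w hw => mem_nhdsWithin_of_mem_nhds (Iio_mem_nhds (hlt p hpU w hw)))
      ?_ ?_
    · intro s hs
      have h1 : ∀ᶠ x in 𝓝[U] p, s ∈ 𝓝[U] x := eventually_eventually_nhdsWithin.2 hs
      filter_upwards [h1, self_mem_nhdsWithin] with x hx hxU
      rwa [hUo.nhdsWithin_eq hxU] at hx
    · intro x hx
      rcases lt_trichotomy x p with h | h | h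
      · right
        filter_upwards [Iio_mem_nhds h] with z hz hzU
        exact lt_asymm hz (hlt p hpU z hzU)
      · left; rw [h]; exact nhdsWithin_le_nhds
      · exfalso
        obtain ⟨z, hz, hzU⟩ := mem_closure_iff_nhds.1 hpc _ (Iio_mem_nhds h)
        exact lt_asymm hz (hlt x hx z hzU)
  · push Not at hp
    obtain ⟨a0, ha0⟩ := hne
    haveI : Nonempty U := ⟨⟨a0, ha0⟩⟩
    have hF : ∀ s : Set X, s ∈ map ((↑) : U → X) atBot ↔ ∃ a ∈ U, ∀ x ∈ U, x < a → x ∈ s := by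
      intro s
      rw [mem_map, mem_atBot_sets]
      constructor
      · rintro ⟨a, ha⟩
        exact ⟨a, a.2, fun x hx hax => ha ⟨x, hx⟩ (le_of_lt hax)⟩
      · rintro ⟨a, ha, h⟩
        obtain ⟨b, hb, hab⟩ := hmin a ha
        exact ⟨⟨b, hb⟩, fun c hc => h c c.2 (lt_of_le_of_lt hc hab)⟩
    refine caseTwo hXcont H U hU ⟨a0, ha0⟩ hmin (map ((↑) : U → X) atBot) inferInstance
      ((hF _).2 ⟨a0, ha0, fun x hx _ => hx⟩) (fun w hw => (hF _).2 ⟨w, hw, fun x _ h => h⟩) ?_ ?_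
    · intro s hs
      obtain ⟨a, ha, h⟩ := (hF _).1 hs
      refine (hF _).2 ⟨a, ha, fun x hx hxa => ?_⟩
      filter_upwards [hUo.mem_nhds hx, Iio_mem_nhds hxa] with z h1 h2 using h z h1 h2
    · intro x hx
      right
      have := hp x hx
      rwa [← mem_compl_iff, ← interior_compl, mem_interior_iff_mem_nhds] at this

lemma finite_of_HClosed [TopologicalSpace X] [T2Space X]
    (hXcont : Continuous fun p : X × X => p.1 ⊓ p.2)
    (H : HClosed X) : Finite X := by
  haveI : OrderClosedTopology X := by
    refine ⟨?_⟩
    have : {p : X × X | p.1 ≤ p.2} = {p | p.1 ⊓ p.2 = p.1} := by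
      ext p; simp
    rw [this]
    exact isClosed_eq hXcont continuous_fst
  haveI : WellFoundedGT X := by
    by_contra hw
    rw [WellFoundedGT, isWellFounded_iff, WellFounded.wellFounded_iff_has_min] at hw
    push Not at hw
    obtain ⟨S, hS, h⟩ := hw
    refine caseOne hXcont H {x | ∃ s ∈ S, x ≤ s} ?_ ?_ ?_
    · rintro a b hab ⟨s, hs, h⟩
      exact ⟨s, hs, hab.trans h⟩
    · exact hS.mono fun s hs => ⟨s, hs, le_rfl⟩
    · rintro x ⟨s, hs, hx⟩
      obtain ⟨t, ht, hst⟩ := h s hs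
      exact ⟨t, ⟨t, ht, le_rfl⟩, lt_of_le_of_lt hx hst⟩
  haveI : WellFoundedLT X := by
    by_contra hw
    rw [WellFoundedLT, isWellFounded_iff, WellFounded.wellFounded_iff_has_min] at hw
    push Not at hw
    obtain ⟨S, hS, h⟩ := hw
    refine caseThree hXcont H {x | ∃ s ∈ S, s ≤ x} ?_ ?_ ?_
    · rintro a b hab ⟨s, hs, h⟩
      exact ⟨s, hs, h.trans hab⟩
    · exact hS.mono fun s hs => ⟨s, hs, le_rfl⟩
    · rintro x ⟨s, hs, hx⟩
      obtain ⟨t, ht, hst⟩ := h s hs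
      exact ⟨t, ⟨t, ht, le_rfl⟩, lt_of_lt_of_le hst hx⟩
  exact Finite.of_wellFoundedLT_wellFoundedGT X

end Two

/-- A linear Hausdorff topological semilattice `X` is finite if and only if every
isomorphic topological embedding of `X` into a `T₁` topological semilattice has
closed image. -/
theorem stmt17 {X : Type u} [SemilatticeInf X] [TopologicalSpace X] [T2Space X]
    (hXcont : Continuous fun p : X × X => p.1 ⊓ p.2)
    (hlin : ∀ x y : X, x ⊓ y = x ∨ x ⊓ y = y) :
    Finite X ↔
      ∀ (Y : Type u) [SemilatticeInf Y] [TopologicalSpace Y] [T1Space Y],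
        (Continuous fun p : Y × Y => p.1 ⊓ p.2) →
        ∀ f : X → Y, (∀ a b : X, f (a ⊓ b) = f a ⊓ f b) → IsEmbedding f →
          IsClosed (Set.range f) := by
  constructor
  · intro hfin Y _ _ _ _ f _ _
    exact (Set.finite_range f).isClosed
  · intro H
    classical
    have htot : ∀ a b : X, a ≤ b ∨ b ≤ a := fun a b =>
      (hlin a b).imp inf_eq_left.1 inf_eq_right.1
    letI l : LinearOrder X :=
      { ‹SemilatticeInf X› with
        min := fun a b => a ⊓ b
        le_total := htot
        toDecidableLE := Classical.decRel _
        min_def := by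
          intro a b
          split_ifs with h
          · exact inf_eq_left.2 h
          · exact inf_eq_right.2 ((htot a b).resolve_left h) }
    exact @finite_of_HClosed X l _ _ hXcont H
end
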